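/- Assume f satisfies the basic assumptions and hypothesis (H), and in addition there exists ε₀ > 0 such that for every (t,x) ∈ ℝ², f(t,x,·) is C² on the interval I_{t,x} := [(1−ε₀)p(t,x), (1+ε₀)p(t,x)], the map u ↦ f(t,x,u)/u is nonincreasing on I_{t,x}, and f_uu(t,x,u) ≤ 0 for u ∈ I_{t,x}. Let v₀ : ℝ → ℝ be continuous, nonnegative and compactly supported, and let v be a bounded nonnegative classical solution of the Cauchy problem v_t = d v_xx + f(t,x,v) on (0,∞) × ℝ with v(0,·) = v₀. Then there exist t₀ > 0 and δ₀ > 0 such that v(t₀,x) ≤ p(0,x) − δ₀ for all x ∈ ℝ. -/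

import Mathlib

open Filter Topology Set

noncomputable section

/-- `u` solves `u_t = d u_xx + f(t,x,u)` classically at every point `(t,x)` of the set `s`:
the spatial function is twice differentiable there and the time derivative exists and
equals `d u_xx + f(t,x,u)`. -/
def SolvesPDE (d : ℝ) (f : ℝ → ℝ → ℝ → ℝ) (u : ℝ → ℝ → ℝ) (s : Set (ℝ × ℝ)) : Prop :=
  ∀ q ∈ s,
    DifferentiableAt ℝ (u q.1) q.2 ∧
    DifferentiableAt ℝ (deriv (u q.1)) q.2 ∧
    HasDerivAt (fun t => u t q.2)
      (d * deriv (deriv (u q.1)) q.2 + f q.1 q.2 (u q.1 q.2)) q.1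

/-- Basic assumptions on the reaction term `f(t,x,u)` (for `u ≥ 0`): continuity,
Hölder continuity of class `C^{α/2,α}` in `(t,x)` locally uniformly in `u`,
`C¹` in `u` uniformly in `(t,x)`, `f(t,x,0) = 0`, nonpositivity for large `u`,
and space-time periodicity. -/
structure BasicAssumptions (ω L : ℝ) (f : ℝ → ℝ → ℝ → ℝ) : Prop where
  cont : ContinuousOn (fun q : ℝ × ℝ × ℝ => f q.1 q.2.1 q.2.2) {q : ℝ × ℝ × ℝ | 0 ≤ q.2.2}
  holder : ∃ α ∈ Set.Ioo (0:ℝ) 1, ∀ R > 0, ∃ C > 0, ∀ t s x y u : ℝ,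
    0 ≤ u → u ≤ R → |f t x u - f s y u| ≤ C * (|t - s| ^ (α / 2) + |x - y| ^ α)
  c1 : ∃ fu : ℝ → ℝ → ℝ → ℝ,
    (∀ t x u : ℝ, 0 ≤ u → HasDerivWithinAt (fun w => f t x w) (fu t x u) (Set.Ici 0) u) ∧
    ∀ ε > 0, ∃ δ > 0, ∀ t x u v : ℝ, 0 ≤ u → 0 ≤ v → |u - v| ≤ δ →
      |fu t x u - fu t x v| ≤ ε
  zero : ∀ t x : ℝ, f t x 0 = 0
  neg_large : ∃ M > 0, ∀ t x u : ℝ, M ≤ u → f t x u ≤ 0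
  per_t : ∀ t x u : ℝ, 0 ≤ u → f (t + ω) x u = f t x u
  per_x : ∀ t x u : ℝ, 0 ≤ u → f t (x + L) u = f t x u

/-- A bounded classical solution of the Cauchy problem
`v_t = d v_xx + f(t,x,v)` on `(0,∞) × ℝ` with initial datum `v₀`. -/
structure IsCauchySolution (d : ℝ) (f : ℝ → ℝ → ℝ → ℝ) (v₀ : ℝ → ℝ) (v : ℝ → ℝ → ℝ) : Prop where
  init : ∀ x, v 0 x = v₀ x
  cont : ContinuousOn (fun q : ℝ × ℝ => v q.1 q.2) {q : ℝ × ℝ | 0 ≤ q.1}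
  pde : SolvesPDE d f v {q : ℝ × ℝ | 0 < q.1}
  bdd : ∃ C, ∀ t ≥ (0:ℝ), ∀ x, |v t x| ≤ C

/-- Hypothesis (H): `p` is the unique positive space-time periodic solution of
`p_t = d p_xx + f(t,x,p)`, and every bounded solution of the Cauchy problem with
initial datum bounded below by a positive constant converges to `p` uniformly. -/
structure HypH (d ω L : ℝ) (f : ℝ → ℝ → ℝ → ℝ) (p : ℝ → ℝ → ℝ) : Prop where
  pos : ∀ t x, 0 < p t x
  per_t : ∀ t x, p (t + ω) x = p t x
  per_x : ∀ t x, p t (x + L) = p t x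
  sol : SolvesPDE d f p Set.univ
  uniq : ∀ q : ℝ → ℝ → ℝ, (∀ t x, 0 < q t x) → (∀ t x, q (t + ω) x = q t x) →
    (∀ t x, q t (x + L) = q t x) → SolvesPDE d f q Set.univ → q = p
  conv : ∀ v₀ : ℝ → ℝ, Continuous v₀ → (∃ C, ∀ x, |v₀ x| ≤ C) →
    (∃ ε > 0, ∀ x, ε ≤ v₀ x) →
    ∀ v : ℝ → ℝ → ℝ, IsCauchySolution d f v₀ v →
    ∀ ε > 0, ∃ S, ∀ s ≥ S, ∀ t ≥ (0:ℝ), ∀ x : ℝ, |v (t + s) x - p (t + s) x| ≤ ε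



/-- `u_t = d u_xx + g` classically for `t > 0`. -/
def HeatOp (d : ℝ) (u g : ℝ → ℝ → ℝ) : Prop :=
  ∀ t > 0, ∀ x, DifferentiableAt ℝ (u t) x ∧ DifferentiableAt ℝ (deriv (u t)) x ∧
    HasDerivAt (fun s => u s x) (d * deriv (deriv (u t)) x + g t x) t

theorem HeatOp.congr {d : ℝ} {u g g' : ℝ → ℝ → ℝ} (h : HeatOp d u g)
    (hg : ∀ t > 0, ∀ x, g t x = g' t x) : HeatOp d u g' := by
  intro t ht x
  obtain ⟨h1, h2, h3⟩ := h t ht x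
  exact ⟨h1, h2, by rw [← hg t ht x]; exact h3⟩

theorem HeatOp.congr_left {d : ℝ} {u u' g : ℝ → ℝ → ℝ} (h : HeatOp d u g)
    (hu : ∀ t > 0, ∀ x, u t x = u' t x) : HeatOp d u' g := by
  intro t ht x
  obtain ⟨h1, h2, h3⟩ := h t ht x
  have e : u t = u' t := funext (hu t ht)
  rw [← e]
  refine ⟨h1, h2, h3.congr_of_eventuallyEq ?_⟩
  filter_upwards [lt_mem_nhds ht] with s hs
  exact (hu s hs x).symm

theorem HeatOp.add {d : ℝ} {u g u' g' : ℝ → ℝ → ℝ} (h : HeatOp d u g) (h' : HeatOp d u' g') :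
    HeatOp d (fun t x => u t x + u' t x) (fun t x => g t x + g' t x) := by
  intro t ht x
  obtain ⟨h1, h2, h3⟩ := h t ht x
  obtain ⟨k1, k2, k3⟩ := h' t ht x
  have e : deriv (fun x => u t x + u' t x) = fun x => deriv (u t) x + deriv (u' t) x := by
    funext y
    exact ((h t ht y).1.hasDerivAt.add (h' t ht y).1.hasDerivAt).deriv
  have e2 : HasDerivAt (fun x => deriv (u t) x + deriv (u' t) x)
    (deriv (deriv (u t)) x + deriv (deriv (u' t)) x) x := h2.hasDerivAt.add k2.hasDerivAt
  refine ⟨h1.add k1, by rw [e]; exact e2.differentiableAt, ?_⟩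
  rw [e, e2.deriv]
  convert! h3.add k3 using 1
  ring

theorem HeatOp.const_mul {d : ℝ} {u g : ℝ → ℝ → ℝ} (h : HeatOp d u g) (c : ℝ) :
    HeatOp d (fun t x => c * u t x) (fun t x => c * g t x) := by
  intro t ht x
  obtain ⟨h1, h2, h3⟩ := h t ht x
  have e : deriv (fun x => c * u t x) = fun x => c * deriv (u t) x := by
    funext y
    exact ((h t ht y).1.hasDerivAt.const_mul c).deriv
  have e2 : HasDerivAt (fun x => c * deriv (u t) x) (c * deriv (deriv (u t)) x) x :=
    h2.hasDerivAt.const_mul c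
  refine ⟨h1.const_mul c, by rw [e]; exact e2.differentiableAt, ?_⟩
  rw [e, e2.deriv]
  convert! h3.const_mul c using 1
  ring

theorem HeatOp.sub {d : ℝ} {u g u' g' : ℝ → ℝ → ℝ} (h : HeatOp d u g) (h' : HeatOp d u' g') :
    HeatOp d (fun t x => u t x - u' t x) (fun t x => g t x - g' t x) := by
  have := h.add (h'.const_mul (-1))
  convert this using 3 <;> ring

/-- multiplication by a differentiable function of time -/
theorem HeatOp.time_mul {d : ℝ} {u g : ℝ → ℝ → ℝ} (h : HeatOp d u g) (c c' : ℝ → ℝ)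
    (hc : ∀ t > 0, HasDerivAt c (c' t) t) :
    HeatOp d (fun t x => c t * u t x) (fun t x => c t * g t x + c' t * u t x) := by
  intro t ht x
  obtain ⟨h1, h2, h3⟩ := (h.const_mul (c t)) t ht x
  obtain ⟨k1, k2, k3⟩ := h t ht x
  refine ⟨h1, h2, ?_⟩
  have e : deriv (fun x => c t * u t x) = fun x => c t * deriv (u t) x := by
    funext y
    exact ((h t ht y).1.hasDerivAt.const_mul _).deriv
  have e2 : HasDerivAt (fun x => c t * deriv (u t) x) (c t * deriv (deriv (u t)) x) x :=
    k2.hasDerivAt.const_mul _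
  rw [e, e2.deriv]
  convert! (hc t ht).mul k3 using 1
  ring

theorem HeatOp.exp_mul {d : ℝ} {u g : ℝ → ℝ → ℝ} (h : HeatOp d u g) (c : ℝ) :
    HeatOp d (fun t x => Real.exp (c * t) * u t x)
      (fun t x => Real.exp (c * t) * (g t x + c * u t x)) := by
  refine (h.time_mul (fun t => Real.exp (c * t)) (fun t => Real.exp (c * t) * c) ?_).congr ?_
  · intro t _
    have := ((hasDerivAt_id t).const_mul c).exp
    simpa using this
  · intro t _ x
    ring

theorem HeatOp.const (d K : ℝ) : HeatOp d (fun _ _ => K) (fun _ _ => 0) := by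
  intro t ht x
  refine ⟨by simp, by simp, ?_⟩
  simpa using hasDerivAt_const t K

theorem HeatOp.translate {d : ℝ} {u g : ℝ → ℝ → ℝ} (h : HeatOp d u g) (a : ℝ) :
    HeatOp d (fun t x => u t (x + a)) (fun t x => g t (x + a)) := by
  intro t ht x
  obtain ⟨h1, h2, h3⟩ := h t ht (x + a)
  have e : deriv (fun x => u t (x + a)) = fun x => deriv (u t) (x + a) := by
    funext y
    exact deriv_comp_add_const (u t) a y
  have e2 : deriv (fun x => deriv (u t) (x + a)) x = deriv (deriv (u t)) (x + a) :=
    deriv_comp_add_const (deriv (u t)) a x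
  refine ⟨?_, ?_, ?_⟩
  · exact (h1.hasDerivAt.comp_add_const x a).differentiableAt
  · rw [e]; exact (h2.hasDerivAt.comp_add_const x a).differentiableAt
  · rw [e, e2]; exact h3

theorem HeatOp.shift {d : ℝ} {u g : ℝ → ℝ → ℝ} (h : HeatOp d u g) (a : ℝ) (ha : 0 ≤ a) :
    HeatOp d (fun t x => u (t + a) x) (fun t x => g (t + a) x) := by
  intro t ht x
  obtain ⟨h1, h2, h3⟩ := h (t + a) (by linarith) x
  exact ⟨h1, h2, h3.comp_add_const t a⟩

theorem HeatOp.exp_exp (d A b : ℝ) :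
    HeatOp d (fun t x => Real.exp (A * t) * Real.exp (b * x))
      (fun t x => (A - d * b ^ 2) * (Real.exp (A * t) * Real.exp (b * x))) := by
  have h1 : ∀ x, HasDerivAt (fun x => Real.exp (b * x)) (b * Real.exp (b * x)) x := by
    intro x
    have := ((hasDerivAt_id x).const_mul b).exp
    simp only [id, mul_one] at this
    rw [mul_comm]; exact this
  have e : deriv (fun x => Real.exp (b * x)) = fun x => b * Real.exp (b * x) :=
    funext fun x => (h1 x).deriv
  have e2 : deriv (fun x => b * Real.exp (b * x)) = fun x => b * (b * Real.exp (b * x)) :=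
    funext fun x => ((h1 x).const_mul b).deriv
  have h0 : HeatOp d (fun _ x => Real.exp (b * x)) (fun _ x => - (d * (b * (b * Real.exp (b * x))))) := by
    intro t ht x
    refine ⟨(h1 x).differentiableAt, by rw [e]; exact ((h1 x).const_mul b).differentiableAt, ?_⟩
    rw [e, e2]
    simpa using hasDerivAt_const t (Real.exp (b * x))
  refine (h0.exp_mul A).congr ?_
  intro t _ x
  ring

theorem deriv2_nonpos_of_isLocalMax {φ : ℝ → ℝ} {x : ℝ} (h1 : DifferentiableAt ℝ φ x)
    (h : IsLocalMax φ x) : deriv (deriv φ) x ≤ 0 := by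
  by_contra hcon
  push Not at hcon
  have hm := isLocalMin_of_deriv_deriv_pos hcon h.deriv_eq_zero h1.continuousAt
  have he : φ =ᶠ[𝓝 x] fun _ => φ x := by
    filter_upwards [h, hm] with y a b
    exact le_antisymm a b
  have := he.deriv.deriv_eq
  simp at this
  linarith

theorem max_principle {d : ℝ} (hd : 0 ≤ d) {z g : ℝ → ℝ → ℝ} (hz : HeatOp d z g)
    (hc : ContinuousOn (fun q : ℝ × ℝ => z q.1 q.2) {q | 0 ≤ q.1})
    (hb : ∀ T, ∃ B, ∀ t, 0 ≤ t → t ≤ T → ∀ x, z t x ≤ B)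
    (h0 : ∀ x, z 0 x ≤ 0) (C : ℝ)
    (hg : ∀ t > 0, ∀ x, 0 < z t x → g t x ≤ C * z t x) :
    ∀ t ≥ 0, ∀ x, z t x ≤ 0 := by
  intro T hT X
  by_contra hcon
  push Not at hcon
  obtain ⟨B, hB⟩ := hb T
  set ρ : ℝ → ℝ → ℝ := fun t x => x ^ 2 + (2 * d + 1) * t with hρ
  have hρ0 : ∀ t ≥ 0, ∀ x, 0 ≤ ρ t x := fun t ht x => by positivity
  have hρH : HeatOp d ρ (fun _ _ => 1) := by
    intro t ht x
    have a1 : ∀ x, HasDerivAt (ρ t) (2 * x) x := by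
      intro x
      have := ((hasDerivAt_id x).pow 2).add_const ((2 * d + 1) * t)
      simpa [hρ] using! this
    have e1 : deriv (ρ t) = fun x => 2 * x := funext fun x => (a1 x).deriv
    have a2 : HasDerivAt (fun x : ℝ => 2 * x) 2 x := by
      simpa using (hasDerivAt_id x).const_mul 2
    refine ⟨(a1 x).differentiableAt, by rw [e1]; exact a2.differentiableAt, ?_⟩
    rw [e1, a2.deriv]
    have := ((hasDerivAt_id t).const_mul (2 * d + 1)).const_add (x ^ 2)
    convert! this using 1
    ring
  set E : ℝ → ℝ := fun t => Real.exp (-(C + 1) * t) with hE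
  have hEpos : ∀ t, 0 < E t := fun t => Real.exp_pos _
  obtain ⟨ε, hε, hεX⟩ : ∃ ε > 0, 0 < E T * z T X - ε * ρ T X := by
    have h1 : 0 < E T * z T X := mul_pos (hEpos T) hcon
    refine ⟨E T * z T X / (2 * (ρ T X + 1)), by have := hρ0 T hT X; positivity, ?_⟩
    have h2 := hρ0 T hT X
    have : E T * z T X / (2 * (ρ T X + 1)) * ρ T X ≤ E T * z T X / 2 := by
      rw [div_mul_eq_mul_div, div_le_div_iff₀ (by positivity) (by norm_num)]
      nlinarith
    linarith
  set y : ℝ → ℝ → ℝ := fun t x => E t * z t x - ε * ρ t x with hy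
  have hyH := (hz.exp_mul (-(C + 1))).sub (hρH.const_mul ε)
  -- bound on E * z
  obtain ⟨B', hB'0, hB'⟩ : ∃ B' ≥ 0, ∀ t, 0 ≤ t → t ≤ T → ∀ x, E t * z t x ≤ B' := by
    refine ⟨Real.exp (|C + 1| * T) * |B|, by positivity, ?_⟩
    intro t ht htT x
    have h1 : E t ≤ Real.exp (|C + 1| * T) := by
      apply Real.exp_le_exp.mpr
      have := neg_abs_le (C + 1)
      nlinarith [abs_nonneg (C + 1)]
    calc E t * z t x ≤ E t * |B| := by
          gcongr
          exact (hB t ht htT x).trans (le_abs_self B)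
      _ ≤ _ := by gcongr
  set R : ℝ := |X| + 1 + B' / ε with hR
  have hR1 : |X| + 1 ≤ R := by have : 0 ≤ B' / ε := by positivity
                               linarith
  have hR0 : 1 ≤ R := by have := abs_nonneg X; linarith
  have hout : ∀ t, 0 ≤ t → t ≤ T → ∀ x, R ≤ |x| → y t x ≤ 0 := by
    intro t ht htT x hx
    have h1 := hB' t ht htT x
    have h2 : B' ≤ ε * ρ t x := by
      have h3 : B' / ε ≤ R := by have := abs_nonneg X; linarith
      have h4 : R ≤ x ^ 2 := by
        rw [← sq_abs]; nlinarith
      have h5 : B' / ε ≤ ρ t x := by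
        have : 0 ≤ (2 * d + 1) * t := by positivity
        simp only [hρ]; linarith
      rw [div_le_iff₀ hε] at h5
      linarith
    simp only [hy]; linarith
  have hcomp : IsCompact (Icc (0:ℝ) T ×ˢ Icc (-R) R) := isCompact_Icc.prod isCompact_Icc
  have hycont : ContinuousOn (fun q : ℝ × ℝ => y q.1 q.2) (Icc (0:ℝ) T ×ˢ Icc (-R) R) := by
    have h1 : ContinuousOn (fun q : ℝ × ℝ => z q.1 q.2) (Icc (0:ℝ) T ×ˢ Icc (-R) R) :=
      hc.mono fun q hq => hq.1.1
    have h2 : Continuous (fun q : ℝ × ℝ => E q.1) := by simp only [hE]; fun_prop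
    have h3 : Continuous (fun q : ℝ × ℝ => ε * ρ q.1 q.2) := by simp only [hρ]; fun_prop
    exact (h2.continuousOn.mul h1).sub h3.continuousOn
  have hXm : ((T, X) : ℝ × ℝ) ∈ Icc (0:ℝ) T ×ˢ Icc (-R) R := by
    refine ⟨⟨hT, le_rfl⟩, abs_le.mp (by linarith)⟩
  obtain ⟨⟨t, x⟩, ⟨htm, hxm⟩, hmax⟩ := hcomp.exists_isMaxOn ⟨_, hXm⟩ hycont
  simp only at htm hxm
  have hypos : 0 < y t x := lt_of_lt_of_le hεX (hmax hXm)
  have htpos : 0 < t := by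
    rcases eq_or_lt_of_le htm.1 with h | h
    · exfalso
      rw [← h] at hypos
      have h1 := h0 x
      have h2 := hρ0 0 le_rfl x
      have h3 := hEpos 0
      simp only [hy] at hypos
      nlinarith
    · exact h
  have hxlt : |x| < R := by
    by_contra hh
    push Not at hh
    have := hout t htm.1 htm.2 x hh
    linarith
  obtain ⟨k1, k2, k3⟩ := hyH t htpos x
  have hlm : IsLocalMax (y t) x := by
    have : ∀ᶠ x' in 𝓝 x, |x'| < R := (continuous_abs.tendsto x).eventually (gt_mem_nhds hxlt)
    filter_upwards [this] with x' hx'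
    have h1 : ((t, x') : ℝ × ℝ) ∈ Icc (0:ℝ) T ×ˢ Icc (-R) R := ⟨htm, abs_le.mp hx'.le⟩
    exact hmax h1
  have hxx := deriv2_nonpos_of_isLocalMax k1 hlm
  have hzpos : 0 < z t x := by
    have h2 := hρ0 t htm.1 x
    have h3 := hEpos t
    simp only [hy] at hypos
    by_contra hh
    push Not at hh
    nlinarith
  -- time derivative nonneg
  have hyt : 0 ≤ d * deriv (deriv (y t)) x +
      (Real.exp (-(C + 1) * t) * (g t x + -(C + 1) * z t x) - ε * 1) := by
    by_contra hneg
    push Not at hneg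
    have h1 := k3.tendsto_slope
    have h2 : ∀ᶠ s in 𝓝[<] t, slope (fun s => y s x) t s < 0 :=
      (h1.mono_left (nhdsLT_le_nhdsNE t)).eventually (gt_mem_nhds hneg)
    have h3 : ∀ᶠ s in 𝓝[<] t, 0 < s := mem_nhdsWithin_of_mem_nhds (lt_mem_nhds htpos)
    obtain ⟨s, hs1, hs2, hs3⟩ := (h2.and (h3.and self_mem_nhdsWithin)).exists
    have hs3 : s < t := hs3
    rw [slope_def_field] at hs1
    have h4 : y s x ≤ y t x := hmax (show ((s, x) : ℝ × ℝ) ∈ _ from ⟨⟨hs2.le, by linarith [htm.2]⟩, hxm⟩)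
    have : 0 ≤ (y s x - y t x) / (s - t) := div_nonneg_of_nonpos (by linarith) (by linarith)
    linarith
  have h5 := hg t htpos x hzpos
  have h6 : Real.exp (-(C + 1) * t) * (g t x + -(C + 1) * z t x) ≤ 0 := by
    apply mul_nonpos_of_nonneg_of_nonpos (Real.exp_pos _).le
    linarith
  have h7 : d * deriv (deriv (y t)) x ≤ 0 := mul_nonpos_of_nonneg_of_nonpos hd hxx
  linarith


open MeasureTheory

/-- integrable weight -/
def Wt (ψ : ℝ → ℝ) : Prop := Continuous ψ ∧ ∃ C, 0 ≤ C ∧ ∀ y, |ψ y| ≤ C * (1 + y ^ 2)⁻¹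

theorem Wt.integrable {ψ : ℝ → ℝ} (h : Wt ψ) : Integrable ψ := by
  obtain ⟨hc, C, _, hC⟩ := h
  refine (integrable_inv_one_add_sq.const_mul C).mono' hc.aestronglyMeasurable ?_
  exact Eventually.of_forall fun y => by simpa using hC y

theorem Wt.integrable_mul {ψ : ℝ → ℝ} (h : Wt ψ) {G : ℝ → ℝ} (hG : Continuous G) {B : ℝ}
    (hB : ∀ x, |G x| ≤ B) (s x : ℝ) : Integrable fun y => G (x + s * y) * ψ y := by
  refine (h.integrable.abs.const_mul B).mono' ?_ ?_
  · exact ((hG.comp (by fun_prop)).mul h.1).aestronglyMeasurable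
  · refine Eventually.of_forall fun y => ?_
    rw [Real.norm_eq_abs, abs_mul]
    gcongr
    exact hB _

/-- convolution-type integral -/
def JJ (ψ G : ℝ → ℝ) (s x : ℝ) : ℝ := ∫ y, G (x + s * y) * ψ y

theorem JJ_bound {ψ G : ℝ → ℝ} (h : Wt ψ) {B : ℝ} (hB : ∀ x, |G x| ≤ B) (s x : ℝ) :
    |JJ ψ G s x| ≤ B * ∫ y, |ψ y| := by
  unfold JJ
  rw [← integral_const_mul, ← Real.norm_eq_abs]
  refine norm_integral_le_of_norm_le (h.integrable.abs.const_mul B) ?_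
  refine Eventually.of_forall fun y => ?_
  rw [Real.norm_eq_abs, abs_mul]
  gcongr
  exact hB _

theorem JJ_cont {ψ : ℝ → ℝ} (h : Wt ψ) {g : ℝ → ℝ → ℝ} (hg : Continuous fun q : ℝ × ℝ => g q.1 q.2)
    {B : ℝ} (hB : ∀ t x, |g t x| ≤ B) :
    Continuous fun q : ℝ × ℝ × ℝ => JJ ψ (g q.1) q.2.1 q.2.2 := by
  unfold JJ
  refine continuous_of_dominated (bound := fun y => B * |ψ y|) ?_ ?_ (h.integrable.abs.const_mul B) ?_
  · intro q
    have : Continuous (g q.1) := hg.comp (Continuous.prodMk_right q.1)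
    exact ((this.comp (by fun_prop)).mul h.1).aestronglyMeasurable
  · intro q
    refine Eventually.of_forall fun y => ?_
    rw [Real.norm_eq_abs, abs_mul]
    gcongr
    exact hB _ _
  · refine Eventually.of_forall fun y => ?_
    have : Continuous fun q : ℝ × ℝ × ℝ => g q.1 (q.2.2 + q.2.1 * y) :=
      hg.comp (f := fun q : ℝ × ℝ × ℝ => (q.1, q.2.2 + q.2.1 * y)) (by fun_prop)
    exact this.mul continuous_const

theorem JJ_hasDerivAt_x {ψ ψ' G : ℝ → ℝ} (h : Wt ψ) (h' : Wt ψ')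
    (hd : ∀ y, HasDerivAt ψ (ψ' y) y) (hG : Continuous G) {B : ℝ} (hB : ∀ x, |G x| ≤ B)
    {s : ℝ} (hs : 0 < s) (x : ℝ) :
    HasDerivAt (JJ ψ G s) (-(s⁻¹ * JJ ψ' G s x)) x := by
  have e : JJ ψ G s = fun x' => ∫ y, G (x + s * y) * ψ (y - (x' - x) / s) := by
    funext x'
    unfold JJ
    rw [← integral_sub_right_eq_self _ ((x' - x) / s)]
    congr 1
    funext y
    congr 2
    field_simp
    ring
  obtain ⟨C, hC0, hC⟩ := h'.2
  have hB0 : 0 ≤ B := (abs_nonneg _).trans (hB 0)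
  have key := hasDerivAt_integral_of_dominated_loc_of_deriv_le (μ := volume)
    (F := fun x' y => G (x + s * y) * ψ (y - (x' - x) / s))
    (F' := fun x' y => G (x + s * y) * (ψ' (y - (x' - x) / s) * (-(1 / s))))
    (x₀ := x) (s := Metric.ball x s) (bound := fun y => B * (3 * C * (1 + y ^ 2)⁻¹ * (1 / s)))
    (Metric.ball_mem_nhds x hs) ?_ ?_ ?_ ?_ ?_ ?_
  · rw [e]
    convert! key.2 using 1
    unfold JJ
    rw [← integral_const_mul, ← integral_neg]
    congr 1
    funext y
    simp
    ring
  · refine Eventually.of_forall fun x' => ?_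
    exact ((hG.comp (by fun_prop)).mul (h.1.comp (by fun_prop))).aestronglyMeasurable
  · simpa using h.integrable_mul hG hB s x
  · exact ((hG.comp (by fun_prop)).mul ((h'.1.comp (by fun_prop)).mul continuous_const)).aestronglyMeasurable
  · refine Eventually.of_forall fun y x' hx' => ?_
    have h1 : |(x' - x) / s| ≤ 1 := by
      rw [abs_div, abs_of_pos hs, div_le_one hs]
      rw [Metric.mem_ball, Real.dist_eq] at hx'
      exact hx'.le
    rw [Real.norm_eq_abs, abs_mul, abs_mul, abs_neg, abs_of_pos (by positivity : 0 < 1 / s)]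
    gcongr
    · exact hB _
    · refine (hC _).trans ?_
      set k := (x' - x) / s
      rw [show (3:ℝ) * C * (1 + y ^ 2)⁻¹ = C * (3 * (1 + y ^ 2)⁻¹) by ring]
      gcongr
      rw [inv_eq_one_div, ← div_eq_mul_inv, div_le_div_iff₀ (by positivity) (by positivity)]
      have h2 : k ^ 2 ≤ 1 := by rw [← sq_abs]; nlinarith [abs_nonneg k]
      nlinarith [sq_nonneg (y - 2 * k)]
  · exact ((integrable_inv_one_add_sq.const_mul (3 * C)).mul_const (1 / s)).const_mul B
  · refine Eventually.of_forall fun y x' hx' => ?_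
    have h1 : HasDerivAt (fun x' => y - (x' - x) / s) (-(1 / s)) x' :=
      (((hasDerivAt_id x').sub_const x).div_const s).const_sub y
    exact ((hd _).comp x' h1).const_mul _

theorem JJ_hasDerivAt_s {ψ ψ' G : ℝ → ℝ} (h : Wt ψ) (h' : Wt ψ') (h'' : Wt fun y => y * ψ' y)
    (hd : ∀ y, HasDerivAt ψ (ψ' y) y) (hG : Continuous G) {B : ℝ} (hB : ∀ x, |G x| ≤ B)
    {s : ℝ} (hs : 0 < s) (x : ℝ) :
    HasDerivAt (fun s => JJ ψ G s x) (-(s⁻¹ * JJ (fun y => ψ y + y * ψ' y) G s x)) s := by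
  have hB0 : 0 ≤ B := (abs_nonneg _).trans (hB 0)
  obtain ⟨C, hC0, hC⟩ := h.2
  obtain ⟨D, hD0, hD⟩ := h''.2
  have e : ∀ s' > 0, JJ ψ G s' x = ∫ y, G (x + s * y) * (ψ (y * (s / s')) * (s / s')) := by
    intro s' hs'
    unfold JJ
    have hr : 0 < s / s' := by positivity
    have := Measure.integral_comp_mul_right (fun y => G (x + s' * y) * ψ y) (s / s')
    rw [abs_of_pos (by positivity)] at this
    rw [eq_inv_smul_iff₀ hr.ne'] at this
    rw [← this, smul_eq_mul, ← integral_const_mul]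
    congr 1
    funext y
    rw [show s' * (y * (s / s')) = s * y by field_simp]
    ring
  have key := hasDerivAt_integral_of_dominated_loc_of_deriv_le (μ := volume)
    (F := fun r y => G (x + s * y) * (ψ (y * r) * r))
    (F' := fun r y => G (x + s * y) * (ψ (y * r) + (y * r) * ψ' (y * r)))
    (x₀ := 1) (s := Metric.ball 1 (1/2)) (bound := fun y => B * (4 * (C + D) * (1 + y ^ 2)⁻¹))
    (Metric.ball_mem_nhds _ (by norm_num)) ?_ ?_ ?_ ?_ ?_ ?_
  · have h1 : HasDerivAt (fun s' => s / s') (-(s⁻¹)) s := by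
      have := (hasDerivAt_inv hs.ne').const_mul s
      convert! this using 1
      field_simp
    have k2 := key.2
    have h2 : HasDerivAt (fun s' => ∫ y, G (x + s * y) * (ψ (y * (s / s')) * (s / s')))
        ((∫ y, G (x + s * y) * (ψ (y * 1) + (y * 1) * ψ' (y * 1))) * (-(s⁻¹))) s := by
      refine HasDerivAt.comp (h₂ := fun r => ∫ y, G (x + s * y) * (ψ (y * r) * r)) s ?_ h1
      rw [div_self hs.ne']
      exact k2
    have h3 := h2.congr_of_eventuallyEq (f₁ := fun s => JJ ψ G s x) (by
      filter_upwards [lt_mem_nhds hs] with s' hs'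
      exact e s' hs')
    convert! h3 using 1
    unfold JJ
    simp only [mul_one]
    ring
  · refine Eventually.of_forall fun x' => ?_
    exact ((hG.comp (by fun_prop)).mul ((h.1.comp (by fun_prop)).mul continuous_const)).aestronglyMeasurable
  · simpa using h.integrable_mul hG hB s x
  · have : Continuous fun y => ψ (y * 1) + (y * 1) * ψ' (y * 1) := by
      simp only [mul_one]
      exact h.1.add h''.1
    exact ((hG.comp (by fun_prop)).mul this).aestronglyMeasurable
  · refine Eventually.of_forall fun y r hr => ?_
    rw [Metric.mem_ball, Real.dist_eq, abs_lt] at hr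
    rw [Real.norm_eq_abs, abs_mul]
    gcongr
    · exact hB _
    · refine (abs_add_le _ _).trans ((add_le_add (hC _) (hD _)).trans ?_)
      rw [← add_mul]
      rw [show (4:ℝ) * (C + D) * (1 + y ^ 2)⁻¹ = (C + D) * (4 * (1 + y ^ 2)⁻¹) by ring]
      gcongr
      rw [inv_eq_one_div, ← div_eq_mul_inv, div_le_div_iff₀ (by positivity) (by positivity)]
      have : (1:ℝ) / 4 ≤ r ^ 2 := by nlinarith
      nlinarith [sq_nonneg y, mul_le_mul_of_nonneg_left this (sq_nonneg y)]
  · exact (integrable_inv_one_add_sq.const_mul (4 * (C + D))).const_mul B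
  · refine Eventually.of_forall fun y r hr => ?_
    have h1 : HasDerivAt (fun r => y * r) y r := by
      simpa using (hasDerivAt_id r).const_mul y
    have := (((hd _).comp r h1).mul (hasDerivAt_id r)).const_mul (G (x + s * y))
    convert! this using 1
    simp only [Function.comp, id]
    ring

/-- Gaussian -/
def gphi (y : ℝ) : ℝ := (Real.sqrt (2 * Real.pi))⁻¹ * Real.exp (-(y ^ 2) / 2)

theorem gphi_pos (y : ℝ) : 0 < gphi y := by unfold gphi; positivity

theorem gphi_cont : Continuous gphi := by unfold gphi; fun_prop

theorem gphi_hasDerivAt (y : ℝ) : HasDerivAt gphi (-(y * gphi y)) y := by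
  have h : HasDerivAt (fun y : ℝ => -(y ^ 2) / 2) (-y) y := by
    have := (((hasDerivAt_id y).pow 2).neg).div_const 2
    convert! this using 1
    simp
    ring
  have := (h.exp).const_mul (Real.sqrt (2 * Real.pi))⁻¹
  convert! this using 1
  unfold gphi
  ring

theorem gphi_integral : ∫ y, gphi y = 1 := by
  unfold gphi
  rw [integral_const_mul]
  have := integral_gaussian (1 / 2)
  have e : (fun x : ℝ => Real.exp (-(1 / 2) * x ^ 2)) = fun x => Real.exp (-(x ^ 2) / 2) := by
    funext x; congr 1; ring
  rw [e] at this
  rw [this]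
  rw [show Real.pi / (1 / 2) = 2 * Real.pi by ring]
  have : 0 < Real.sqrt (2 * Real.pi) := by positivity
  field_simp

theorem gphi_decay : ∃ C, 0 ≤ C ∧ ∀ y, gphi y * (1 + y ^ 2) ^ 3 ≤ C := by
  refine ⟨(Real.sqrt (2 * Real.pi))⁻¹ * (48 * Real.exp (1 / 2)), by positivity, fun y => ?_⟩
  unfold gphi
  rw [mul_assoc]
  refine mul_le_mul_of_nonneg_left ?_ (by positivity)
  have h1 : (1 + y ^ 2) ^ 3 ≤ 48 * Real.exp ((1 + y ^ 2) / 2) := by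
    have := Real.pow_div_factorial_le_exp ((1 + y ^ 2) / 2) (by positivity) 3
    norm_num [Nat.factorial] at this
    linarith
  calc Real.exp (-(y ^ 2) / 2) * (1 + y ^ 2) ^ 3
      ≤ Real.exp (-(y ^ 2) / 2) * (48 * Real.exp ((1 + y ^ 2) / 2)) := by gcongr
    _ = 48 * (Real.exp (-(y ^ 2) / 2) * Real.exp ((1 + y ^ 2) / 2)) := by ring
    _ = 48 * Real.exp (1 / 2) := by rw [← Real.exp_add]; congr 2; ring

theorem Wt_gphi_mul {q : ℝ → ℝ} (hq : Continuous q) (hb : ∀ y, |q y| ≤ (1 + y ^ 2) ^ 2) :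
    Wt fun y => q y * gphi y := by
  obtain ⟨C, hC0, hC⟩ := gphi_decay
  refine ⟨hq.mul gphi_cont, C, hC0, fun y => ?_⟩
  rw [abs_mul, abs_of_pos (gphi_pos y), ← div_eq_mul_inv, le_div_iff₀ (by positivity)]
  calc |q y| * gphi y * (1 + y ^ 2) ≤ (1 + y ^ 2) ^ 2 * gphi y * (1 + y ^ 2) := by
        have := (gphi_pos y).le
        gcongr
        exact hb y
    _ = gphi y * (1 + y ^ 2) ^ 3 := by ring
    _ ≤ C := hC y

theorem Wt0 : Wt gphi := by
  have := Wt_gphi_mul (q := fun _ => 1) continuous_const (fun y => by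
    rw [abs_one]; nlinarith [sq_nonneg y, sq_nonneg (y ^ 2)])
  simpa using this

theorem abs_le_one_add_sq (y : ℝ) : |y| ≤ 1 + y ^ 2 := by
  rw [← sq_abs]; nlinarith [sq_nonneg (|y| - 1), abs_nonneg y]

theorem Wt1 : Wt fun y => y * gphi y :=
  Wt_gphi_mul continuous_id (fun y => by
    have := abs_le_one_add_sq y
    have h2 : 1 ≤ 1 + y ^ 2 := by nlinarith [sq_nonneg y]
    nlinarith)

theorem Wt2 : Wt fun y => (y ^ 2 - 1) * gphi y :=
  Wt_gphi_mul (by fun_prop) (fun y => by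
    rw [abs_le]; constructor <;> nlinarith [sq_nonneg y, sq_nonneg (y ^ 2)])

theorem Wt2_integral : ∫ y, (y ^ 2 - 1) * gphi y = 0 := by
  have h : ∀ y, HasDerivAt (fun y => -(y * gphi y)) ((y ^ 2 - 1) * gphi y) y := by
    intro y
    have := ((hasDerivAt_id y).mul (gphi_hasDerivAt y)).neg
    convert! this using 1
    simp
    ring
  exact integral_eq_zero_of_hasDerivAt_of_integrable h Wt2.integrable Wt1.integrable.neg

open MeasureTheory

def sg (d τ : ℝ) : ℝ := Real.sqrt (2 * d * τ)

theorem sg_pos {d τ : ℝ} (hd : 0 < d) (hτ : 0 < τ) : 0 < sg d τ := by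
  unfold sg; positivity

theorem sg_sq {d τ : ℝ} (hd : 0 < d) (hτ : 0 ≤ τ) : sg d τ ^ 2 = 2 * d * τ := by
  unfold sg; exact Real.sq_sqrt (by positivity)

theorem sg_cont (d : ℝ) : Continuous (sg d) := by
  unfold sg; fun_prop

theorem sg_hasDerivAt {d τ : ℝ} (hd : 0 < d) (hτ : 0 < τ) :
    HasDerivAt (sg d) (d * (sg d τ)⁻¹) τ := by
  have h1 : HasDerivAt (fun τ => 2 * d * τ) (2 * d) τ := by
    simpa using (hasDerivAt_id τ).const_mul (2 * d)
  have := h1.sqrt (by positivity)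
  convert! this using 1
  unfold sg
  field_simp

def heatP (d τ : ℝ) (G : ℝ → ℝ) (x : ℝ) : ℝ := JJ gphi G (sg d τ) x
def heatP1 (d τ : ℝ) (G : ℝ → ℝ) (x : ℝ) : ℝ := (sg d τ)⁻¹ * JJ (fun y => y * gphi y) G (sg d τ) x
def heatP2 (d τ : ℝ) (G : ℝ → ℝ) (x : ℝ) : ℝ :=
  ((sg d τ)⁻¹) ^ 2 * JJ (fun y => (y ^ 2 - 1) * gphi y) G (sg d τ) x

theorem heatP_zero (d : ℝ) (G : ℝ → ℝ) (x : ℝ) : heatP d 0 G x = G x := by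
  unfold heatP JJ sg
  simp [integral_const_mul, gphi_integral]

theorem heatP_hasDerivAt_x {d τ : ℝ} (hd : 0 < d) (hτ : 0 < τ) {G : ℝ → ℝ} (hG : Continuous G) {B : ℝ}
    (hB : ∀ x, |G x| ≤ B) (x : ℝ) : HasDerivAt (heatP d τ G) (heatP1 d τ G x) x := by
  have h' : Wt fun y => -(y * gphi y) := by
    refine ⟨Wt1.1.neg, ?_⟩
    simpa using Wt1.2
  have := JJ_hasDerivAt_x Wt0 h' gphi_hasDerivAt hG hB (sg_pos hd hτ) x
  convert! this using 1
  unfold heatP1 JJ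
  simp [integral_neg]

theorem Wt2neg : Wt fun y => gphi y + y * -(y * gphi y) := by
  have : (fun y => gphi y + y * -(y * gphi y)) = fun y => -((y ^ 2 - 1) * gphi y) := by
    funext y; ring
  rw [this]
  refine ⟨Wt2.1.neg, ?_⟩
  simpa only [abs_neg] using Wt2.2

theorem JJ_Wt2neg (G : ℝ → ℝ) (s x : ℝ) : JJ (fun y => gphi y + y * -(y * gphi y)) G s x
    = - JJ (fun y => (y ^ 2 - 1) * gphi y) G s x := by
  unfold JJ
  rw [← integral_neg]
  congr 1
  funext y
  ring

theorem heatP1_hasDerivAt_x {d τ : ℝ} (hd : 0 < d) (hτ : 0 < τ) {G : ℝ → ℝ} (hG : Continuous G) {B : ℝ}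
    (hB : ∀ x, |G x| ≤ B) (x : ℝ) : HasDerivAt (heatP1 d τ G) (heatP2 d τ G x) x := by
  have hd1 : ∀ y, HasDerivAt (fun y => y * gphi y) (gphi y + y * -(y * gphi y)) y := by
    intro y
    have := (hasDerivAt_id y).mul (gphi_hasDerivAt y)
    simpa using! this
  have := (JJ_hasDerivAt_x Wt1 Wt2neg hd1 hG hB (sg_pos hd hτ) x).const_mul (sg d τ)⁻¹
  convert! this using 1
  rw [JJ_Wt2neg]
  unfold heatP2
  ring

theorem heatP_hasDerivAt_t {d τ : ℝ} (hd : 0 < d) (hτ : 0 < τ) {G : ℝ → ℝ} (hG : Continuous G) {B : ℝ}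
    (hB : ∀ x, |G x| ≤ B) (x : ℝ) :
    HasDerivAt (fun τ => heatP d τ G x) (d * heatP2 d τ G x) τ := by
  have h' : Wt fun y => -(y * gphi y) := by
    refine ⟨Wt1.1.neg, ?_⟩
    simpa using Wt1.2
  have h'' : Wt fun y => y * -(y * gphi y) := by
    have := Wt_gphi_mul (q := fun y => -(y ^ 2)) (by fun_prop) (fun y => by
      rw [abs_neg, abs_of_nonneg (by positivity)]; nlinarith [sq_nonneg y])
    convert! this using 2
    ring
  have h1 := JJ_hasDerivAt_s Wt0 h' h'' gphi_hasDerivAt hG hB (sg_pos hd hτ) x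
  have h2 := HasDerivAt.comp (h₂ := fun s => JJ gphi G s x) τ h1 (sg_hasDerivAt hd hτ)
  convert! h2 using 1
  rw [JJ_Wt2neg]
  unfold heatP2
  ring

theorem heatP_bound {G : ℝ → ℝ} {B : ℝ} (hB : ∀ x, |G x| ≤ B) (d τ x : ℝ) : |heatP d τ G x| ≤ B := by
  have := JJ_bound Wt0 hB (sg d τ) x
  have e : ∫ y, |gphi y| = 1 := by
    simp_rw [abs_of_pos (gphi_pos _)]
    exact gphi_integral
  rwa [e, mul_one] at this

theorem heatP1_bound {G : ℝ → ℝ} {B : ℝ} (hB : ∀ x, |G x| ≤ B) {d τ : ℝ} (hd : 0 < d) (hτ : 0 < τ)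
    (x : ℝ) : |heatP1 d τ G x| ≤ (B * (∫ y, |y * gphi y|) * (2 * d) ^ (-(1/2) : ℝ)) * τ ^ (-(1/2) : ℝ) := by
  have := JJ_bound Wt1 hB (sg d τ) x
  unfold heatP1
  rw [abs_mul, abs_of_pos (inv_pos.2 (sg_pos hd hτ))]
  have e : (sg d τ)⁻¹ = (2 * d) ^ (-(1/2) : ℝ) * τ ^ (-(1/2) : ℝ) := by
    rw [← Real.mul_rpow (by positivity) hτ.le, Real.rpow_neg (by positivity), ← Real.sqrt_eq_rpow]
    rfl
  rw [mul_assoc (B * _), ← e]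
  have h0 := (sg_pos hd hτ)
  calc (sg d τ)⁻¹ * _ ≤ (sg d τ)⁻¹ * (B * (∫ y, |y * gphi y|)) :=
        mul_le_mul_of_nonneg_left this (by positivity)
    _ = _ := by ring

def N2 : ℝ := ∫ y : ℝ, |(1 + y ^ 2) * (y ^ 2 - 1) * gphi y|

theorem N2_nonneg : 0 ≤ N2 := integral_nonneg fun _ => abs_nonneg _

theorem heatP2_bound {G : ℝ → ℝ} (hG : Continuous G) {B : ℝ} (hB : ∀ x, |G x| ≤ B) {C α : ℝ} (hα : α ∈ Ioo (0:ℝ) 1)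
    (hC : 0 ≤ C) (hH : ∀ x y, |G x - G y| ≤ C * |x - y| ^ α)
    {d τ : ℝ} (hd : 0 < d) (hτ : 0 < τ)
    (x : ℝ) : |heatP2 d τ G x| ≤ (C * N2 * (2 * d) ^ (α / 2 - 1)) * τ ^ (α / 2 - 1) := by
  have hs := sg_pos hd hτ
  have hW : Wt fun y => ((1 + y ^ 2) * (y ^ 2 - 1)) * gphi y := by
    refine Wt_gphi_mul (by fun_prop) fun y => ?_
    rw [abs_mul, abs_of_pos (by positivity), sq (1 + y ^ 2)]
    gcongr
    rw [abs_le]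
    constructor <;> nlinarith [sq_nonneg y]
  have h1 : JJ (fun y => (y ^ 2 - 1) * gphi y) G (sg d τ) x =
      ∫ y, (G (x + sg d τ * y) - G x) * ((y ^ 2 - 1) * gphi y) := by
    unfold JJ
    simp_rw [sub_mul (G _) (G x)]
    rw [integral_sub (Wt2.integrable_mul hG hB _ _) (Wt2.integrable.const_mul _), integral_const_mul,
      Wt2_integral]
    simp
  have h2 : |JJ (fun y => (y ^ 2 - 1) * gphi y) G (sg d τ) x| ≤ C * sg d τ ^ α * N2 := by
    rw [h1, N2, ← integral_const_mul, ← Real.norm_eq_abs]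
    refine norm_integral_le_of_norm_le (hW.integrable.abs.const_mul _) ?_
    refine Eventually.of_forall fun y => ?_
    rw [Real.norm_eq_abs, abs_mul]
    have h3 : |y| ^ α ≤ 1 + y ^ 2 := by
      rcases le_total |y| 1 with h | h
      · have := Real.rpow_le_one (abs_nonneg y) h hα.1.le
        nlinarith [sq_nonneg y]
      · have := Real.rpow_le_rpow_of_exponent_le h hα.2.le
        rw [Real.rpow_one] at this
        exact this.trans (abs_le_one_add_sq y)
    have h4 : |G (x + sg d τ * y) - G x| ≤ C * (sg d τ ^ α * (1 + y ^ 2)) := by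
      refine (hH _ _).trans ?_
      rw [add_sub_cancel_left, abs_mul, abs_of_pos hs, Real.mul_rpow hs.le (abs_nonneg _)]
      gcongr
    calc _ ≤ C * (sg d τ ^ α * (1 + y ^ 2)) * |(y ^ 2 - 1) * gphi y| :=
          mul_le_mul_of_nonneg_right h4 (abs_nonneg _)
      _ = _ := by
          rw [mul_assoc (1 + y ^ 2), abs_mul (1 + y ^ 2), abs_of_pos (by positivity : 0 < 1 + y ^ 2)]
          ring
  have e : ((sg d τ)⁻¹) ^ 2 * sg d τ ^ α = (2 * d) ^ (α / 2 - 1) * τ ^ (α / 2 - 1) := by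
    rw [← Real.mul_rpow (by positivity) hτ.le, ← sg_sq hd hτ.le, ← Real.rpow_natCast (sg d τ) 2,
      ← Real.rpow_mul hs.le, inv_pow, ← Real.rpow_natCast (sg d τ) 2, ← Real.rpow_neg hs.le,
      ← Real.rpow_add hs]
    congr 1
    push_cast
    ring
  unfold heatP2
  rw [abs_mul, abs_of_pos (by positivity)]
  calc _ ≤ ((sg d τ)⁻¹) ^ 2 * (C * sg d τ ^ α * N2) := mul_le_mul_of_nonneg_left h2 (by positivity)
    _ = C * N2 * (((sg d τ)⁻¹) ^ 2 * sg d τ ^ α) := by ring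
    _ = _ := by rw [e]; ring

theorem heatP_cont (d : ℝ) {g : ℝ → ℝ → ℝ} (hg : Continuous fun q : ℝ × ℝ => g q.1 q.2)
    {B : ℝ} (hB : ∀ t x, |g t x| ≤ B) :
    Continuous fun q : ℝ × ℝ × ℝ => heatP d q.2.1 (g q.1) q.2.2 := by
  have := (JJ_cont Wt0 hg hB).comp (f := fun q : ℝ × ℝ × ℝ => (q.1, sg d q.2.1, q.2.2))
    (by have := sg_cont d; fun_prop)
  exact this

theorem heatP1_contOn {d : ℝ} (hd : 0 < d) {g : ℝ → ℝ → ℝ} (hg : Continuous fun q : ℝ × ℝ => g q.1 q.2)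
    {B : ℝ} (hB : ∀ t x, |g t x| ≤ B) :
    ContinuousOn (fun q : ℝ × ℝ × ℝ => heatP1 d q.2.1 (g q.1) q.2.2) {q | 0 < q.2.1} := by
  have := (JJ_cont Wt1 hg hB).comp (f := fun q : ℝ × ℝ × ℝ => (q.1, sg d q.2.1, q.2.2))
    (by have := sg_cont d; fun_prop)
  refine ContinuousOn.mul (ContinuousOn.inv₀ ?_ ?_) this.continuousOn
  · have := sg_cont d
    exact Continuous.continuousOn (by fun_prop)
  · intro q hq
    exact (sg_pos hd hq).ne'

theorem heatP2_contOn {d : ℝ} (hd : 0 < d) {g : ℝ → ℝ → ℝ} (hg : Continuous fun q : ℝ × ℝ => g q.1 q.2)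
    {B : ℝ} (hB : ∀ t x, |g t x| ≤ B) :
    ContinuousOn (fun q : ℝ × ℝ × ℝ => heatP2 d q.2.1 (g q.1) q.2.2) {q | 0 < q.2.1} := by
  have := (JJ_cont Wt2 hg hB).comp (f := fun q : ℝ × ℝ × ℝ => (q.1, sg d q.2.1, q.2.2))
    (by have := sg_cont d; fun_prop)
  refine ContinuousOn.mul (ContinuousOn.pow (ContinuousOn.inv₀ ?_ ?_) 2) this.continuousOn
  · have := sg_cont d
    exact Continuous.continuousOn (by fun_prop)
  · intro q hq
    exact (sg_pos hd hq).ne'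

theorem heatP_heatOp {d : ℝ} (hd : 0 < d) {G : ℝ → ℝ} (hG : Continuous G) {B : ℝ}
    (hB : ∀ x, |G x| ≤ B) : HeatOp d (fun t x => heatP d t G x) (fun _ _ => 0) := by
  intro t ht x
  have e : deriv (heatP d t G) = heatP1 d t G := funext fun x => (heatP_hasDerivAt_x hd ht hG hB x).deriv
  have h2 := heatP1_hasDerivAt_x hd ht hG hB x
  refine ⟨(heatP_hasDerivAt_x hd ht hG hB x).differentiableAt, ?_, ?_⟩
  · show DifferentiableAt ℝ (deriv (heatP d t G)) x
    rw [e]; exact h2.differentiableAt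
  · show HasDerivAt _ (d * deriv (deriv (heatP d t G)) x + 0) t
    rw [e, h2.deriv, add_zero]
    exact heatP_hasDerivAt_t hd ht hG hB x

/-- triangle Fubini -/
theorem triangle_swap {A : ℝ → ℝ → ℝ} {C β t : ℝ} (hβ : -1 < β) (ht : 0 ≤ t) 
    (hm : ContinuousOn (fun q : ℝ × ℝ => A q.1 q.2) {q | 0 < q.1})
    (hb : ∀ r > 0, ∀ τ, |A r τ| ≤ C * r ^ β) :
    ∫ τ in 0..t, ∫ r in 0..τ, A r τ = ∫ r in 0..t, ∫ τ in r..t, A r τ := by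
  have h1 : ∫ τ in 0..t, ∫ r in 0..τ, A r τ = 
      ∫ τ in 0..t, ∫ r in 0..t, indicator {r | r ≤ τ} (fun r => A r τ) r := by
    refine intervalIntegral.integral_congr fun τ hτ => ?_
    rw [uIcc_of_le ht] at hτ
    exact (intervalIntegral.integral_indicator hτ).symm
  have h2 : ∫ r in 0..t, ∫ τ in r..t, A r τ = 
      ∫ r in 0..t, ∫ τ in 0..t, indicator {r | r ≤ τ} (fun r => A r τ) r := by
    refine intervalIntegral.integral_congr fun r hr => ?_
    rw [uIcc_of_le ht] at hr
    have e : (fun τ => indicator {r | r ≤ τ} (fun r => A r τ) r) = indicator (Ici r) (fun τ => A r τ) := by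
      funext τ
      simp [indicator]
    rw [e, intervalIntegral.integral_of_le hr.2, intervalIntegral.integral_of_le ht,
      integral_indicator measurableSet_Ici, Measure.restrict_restrict measurableSet_Ici,
      ← integral_Icc_eq_integral_Ioc, ]
    refine setIntegral_congr_set ?_
    rcases eq_or_lt_of_le hr.1 with h | h
    · rw [← h, inter_eq_self_of_subset_right (fun x hx => hx.1.le)]
      exact Ioc_ae_eq_Icc.symm
    · have : Ici r ∩ Ioc 0 t = Icc r t := by
        ext y
        simp only [mem_inter_iff, mem_Ici, mem_Ioc, mem_Icc]
        constructor
        · rintro ⟨a, b, c⟩; exact ⟨a, c⟩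
        · rintro ⟨a, b⟩; exact ⟨a, by linarith, b⟩
      rw [this]
      exact EventuallyEq.rfl
  rw [h1, h2]
  refine intervalIntegral_intervalIntegral_swap (F := fun τ r => indicator {r | r ≤ τ} (fun r => A r τ) r) ?_
  rw [uIoc_of_le ht]
  have hi : IntegrableOn (fun r : ℝ => C * r ^ β) (Ioc 0 t) := by
    have := (intervalIntegral.intervalIntegrable_rpow' (a := 0) (b := t) hβ).const_mul C
    rwa [intervalIntegrable_iff_integrableOn_Ioc_of_le ht] at this
  have hi2 : IntegrableOn (fun q : ℝ × ℝ => 1 * (C * q.2 ^ β)) (Ioc 0 t ×ˢ Ioc 0 t) := by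
    rw [IntegrableOn, Measure.volume_eq_prod, ← Measure.prod_restrict]
    exact Integrable.mul_prod (f := fun _ : ℝ => (1:ℝ)) (g := fun r : ℝ => C * r ^ β)
      (integrable_const _) hi
  refine Integrable.mono' hi2 ?_ ?_
  · have e : (fun q : ℝ × ℝ => indicator {r | r ≤ q.1} (fun r => A r q.1) q.2) =
        indicator {q : ℝ × ℝ | q.2 ≤ q.1} (fun q => A q.2 q.1) := by
      funext q
      simp [indicator]
    show AEStronglyMeasurable (fun q : ℝ × ℝ => indicator {r | r ≤ q.1} (fun r => A r q.1) q.2) _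
    rw [e]
    refine AEStronglyMeasurable.indicator ?_ (measurableSet_le measurable_snd measurable_fst)
    refine ContinuousOn.aestronglyMeasurable ?_ (measurableSet_Ioc.prod measurableSet_Ioc)
    refine hm.comp (f := fun q : ℝ × ℝ => (q.2, q.1)) (by fun_prop) ?_
    intro q hq
    exact hq.2.1
  · refine (ae_restrict_iff' (measurableSet_Ioc.prod measurableSet_Ioc)).2 ?_
    refine Eventually.of_forall fun q hq => ?_
    have hq2 : 0 < q.2 := hq.2.1
    rw [one_mul]
    refine le_trans ?_ (hb q.2 hq2 q.1)
    show ‖indicator {r | r ≤ q.1} (fun r => A r q.1) q.2‖ ≤ _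
    rw [← Real.norm_eq_abs]
    exact norm_indicator_le_norm_self (fun r => A r q.1) q.2

open MeasureTheory

theorem sing_integrable {A : ℝ → ℝ} {C β t : ℝ} (hβ : -1 < β) (ht : 0 ≤ t)
    (hm : ContinuousOn A (Ioi 0)) (hb : ∀ τ > 0, |A τ| ≤ C * τ ^ β) :
    IntervalIntegrable A volume 0 t := by
  have := (intervalIntegral.intervalIntegrable_rpow' (a := 0) (b := t) hβ).const_mul C
  rw [intervalIntegrable_iff_integrableOn_Ioc_of_le ht] at this ⊢
  refine Integrable.mono' this ?_ ?_
  · exact (hm.mono (fun x hx => hx.1)).aestronglyMeasurable measurableSet_Ioc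
  · refine (ae_restrict_iff' measurableSet_Ioc).2 ?_
    exact Eventually.of_forall fun q hq => hb q hq.1

theorem sing_bound {A : ℝ → ℝ} {C β t : ℝ} (hβ : -1 < β) (ht : 0 ≤ t)
    (hb : ∀ τ > 0, |A τ| ≤ C * τ ^ β) :
    |∫ τ in 0..t, A τ| ≤ C / (β + 1) * t ^ (β + 1) := by
  have h := (intervalIntegral.intervalIntegrable_rpow' (a := 0) (b := t) hβ).const_mul C
  have := intervalIntegral.norm_integral_le_of_norm_le (f := A) (g := fun τ => C * τ ^ β) ht
    (Eventually.of_forall fun q hq => hb q hq.1) h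
  rw [intervalIntegral.integral_const_mul, integral_rpow (Or.inl hβ)] at this
  refine this.trans (le_of_eq ?_)
  rw [Real.zero_rpow (by linarith)]
  ring

theorem param_deriv {A A' : ℝ → ℝ → ℝ} {C β t x : ℝ} (hβ : -1 < β) (ht : 0 ≤ t)
    (hm : ∀ x, ContinuousOn (fun τ => A τ x) (Ioi 0))
    (hm' : ∀ x, ContinuousOn (fun τ => A' τ x) (Ioi 0))
    (hint : IntervalIntegrable (fun τ => A τ x) volume 0 t)
    (hd : ∀ τ > 0, ∀ x, HasDerivAt (A τ) (A' τ x) x)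
    (hb : ∀ τ > 0, ∀ x, |A' τ x| ≤ C * τ ^ β) :
    HasDerivAt (fun x => ∫ τ in 0..t, A τ x) (∫ τ in 0..t, A' τ x) x := by
  refine (intervalIntegral.hasDerivAt_integral_of_dominated_loc_of_deriv_le (μ := volume)
    (F := fun x τ => A τ x) (F' := fun x τ => A' τ x) (bound := fun τ => C * τ ^ β) (s := univ)
    univ_mem ?_ hint ?_ ?_ ?_ ?_).2
  · refine Eventually.of_forall fun x => ?_
    rw [uIoc_of_le ht]
    exact ((hm x).mono (fun x hx => hx.1)).aestronglyMeasurable measurableSet_Ioc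
  · rw [uIoc_of_le ht]
    exact ((hm' x).mono (fun x hx => hx.1)).aestronglyMeasurable measurableSet_Ioc
  · refine Eventually.of_forall fun τ hτ x _ => ?_
    rw [uIoc_of_le ht] at hτ
    exact hb τ hτ.1 x
  · exact (intervalIntegral.intervalIntegrable_rpow' (a := 0) (b := t) hβ).const_mul C
  · refine Eventually.of_forall fun τ hτ x _ => ?_
    rw [uIoc_of_le ht] at hτ
    exact hd τ hτ.1 x

def duh (d : ℝ) (g : ℝ → ℝ → ℝ) (t x : ℝ) : ℝ := ∫ τ in 0..t, heatP d τ (g (t - τ)) x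
def duh1 (d : ℝ) (g : ℝ → ℝ → ℝ) (t x : ℝ) : ℝ := ∫ τ in 0..t, heatP1 d τ (g (t - τ)) x
def duh2 (d : ℝ) (g : ℝ → ℝ → ℝ) (t x : ℝ) : ℝ := ∫ τ in 0..t, heatP2 d τ (g (t - τ)) x

section
variable {d : ℝ} {g : ℝ → ℝ → ℝ} {B C α : ℝ}

theorem slice_cont (hg : Continuous fun q : ℝ × ℝ => g q.1 q.2) (s : ℝ) : Continuous (g s) :=
  hg.comp (Continuous.prodMk_right s)

theorem duh_cont (hg : Continuous fun q : ℝ × ℝ => g q.1 q.2) (hB : ∀ t x, |g t x| ≤ B) :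
    Continuous fun q : ℝ × ℝ => duh d g q.1 q.2 := by
  unfold duh
  refine intervalIntegral.continuous_parametric_intervalIntegral_of_continuous
    (f := fun (q : ℝ × ℝ) τ => heatP d τ (g (q.1 - τ)) q.2) (s := fun q => q.1) ?_ continuous_fst
  exact (heatP_cont d hg hB).comp (f := fun q : (ℝ × ℝ) × ℝ => (q.1.1 - q.2, q.2, q.1.2)) (by fun_prop)

theorem duh_bound (hB : ∀ t x, |g t x| ≤ B) {t : ℝ} (ht : 0 ≤ t) (x : ℝ) :
    |duh d g t x| ≤ B * t := by
  have := intervalIntegral.norm_integral_le_of_norm_le_const (a := 0) (b := t)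
    (f := fun τ => heatP d τ (g (t - τ)) x) (C := B) (fun τ _ => heatP_bound (hB _) d τ x)
  rwa [sub_zero, abs_of_nonneg ht] at this

theorem duh_hasDerivAt_x (hd : 0 < d) (hg : Continuous fun q : ℝ × ℝ => g q.1 q.2)
    (hB : ∀ t x, |g t x| ≤ B) {t : ℝ} (ht : 0 ≤ t) (x : ℝ) :
    HasDerivAt (duh d g t) (duh1 d g t x) x := by
  refine param_deriv (A := fun τ x => heatP d τ (g (t - τ)) x)
    (A' := fun τ x => heatP1 d τ (g (t - τ)) x) (β := -(1/2)) (by norm_num) ht ?_ ?_ ?_ ?_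
    (fun τ hτ x => heatP1_bound (hB _) hd hτ x)
  · intro x
    exact ((heatP_cont d hg hB).comp (f := fun τ => (t - τ, τ, x)) (by fun_prop)).continuousOn
  · intro x
    refine (heatP1_contOn hd hg hB).comp (f := fun τ => (t - τ, τ, x)) (by fun_prop) ?_
    intro τ hτ; exact hτ
  · exact ((heatP_cont d hg hB).comp (f := fun τ => (t - τ, τ, x)) (by fun_prop)).intervalIntegrable _ _
  · intro τ hτ x
    exact heatP_hasDerivAt_x hd hτ (slice_cont hg _) (hB _) x

theorem duh1_bound (hd : 0 < d) (hB : ∀ t x, |g t x| ≤ B) {t : ℝ} (ht : 0 ≤ t) (x : ℝ) :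
    |duh1 d g t x| ≤ (B * (∫ y, |y * gphi y|) * (2 * d) ^ (-(1/2) : ℝ)) / (-(1/2) + 1) * t ^ (-(1/2) + 1 : ℝ) :=
  sing_bound (by norm_num) ht (fun τ hτ => heatP1_bound (hB _) hd hτ x)

theorem duh1_hasDerivAt_x (hd : 0 < d) (hg : Continuous fun q : ℝ × ℝ => g q.1 q.2)
    (hB : ∀ t x, |g t x| ≤ B) (hα : α ∈ Ioo (0:ℝ) 1)
    (hC : 0 ≤ C) (hH : ∀ t x y, |g t x - g t y| ≤ C * |x - y| ^ α) {t : ℝ} (ht : 0 ≤ t) (x : ℝ) :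
    HasDerivAt (duh1 d g t) (duh2 d g t x) x := by
  have hc1 : ∀ x, ContinuousOn (fun τ => heatP1 d τ (g (t - τ)) x) (Ioi 0) := by
    intro x
    refine (heatP1_contOn hd hg hB).comp (f := fun τ => (t - τ, τ, x)) (by fun_prop) ?_
    intro τ hτ; exact hτ
  refine param_deriv (A := fun τ x => heatP1 d τ (g (t - τ)) x)
    (A' := fun τ x => heatP2 d τ (g (t - τ)) x) (β := α / 2 - 1) (by linarith [hα.1]) ht hc1 ?_ ?_ ?_
    (fun τ hτ x => heatP2_bound (slice_cont hg _) (hB _) hα hC (hH _) hd hτ x)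
  · intro x
    refine (heatP2_contOn hd hg hB).comp (f := fun τ => (t - τ, τ, x)) (by fun_prop) ?_
    intro τ hτ; exact hτ
  · exact sing_integrable (β := -(1/2)) (by norm_num) ht (hc1 x)
      (fun τ hτ => heatP1_bound (hB _) hd hτ x)
  · intro τ hτ x
    exact heatP1_hasDerivAt_x hd hτ (slice_cont hg _) (hB _) x

theorem duh2_cont (hd : 0 < d) (hg : Continuous fun q : ℝ × ℝ => g q.1 q.2)
    (hB : ∀ t x, |g t x| ≤ B) (hα : α ∈ Ioo (0:ℝ) 1)
    (hC : 0 ≤ C) (hH : ∀ t x y, |g t x - g t y| ≤ C * |x - y| ^ α) (x : ℝ) :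
    ContinuousOn (fun t => duh2 d g t x) (Ioi 0) := by
  have e : ∀ t > 0, duh2 d g t x = t * ∫ θ in 0..1, heatP2 d (t * θ) (g (t - t * θ)) x := by
    intro t ht
    have := intervalIntegral.integral_comp_mul_left (fun τ => heatP2 d τ (g (t - τ)) x) ht.ne'
      (a := 0) (b := 1)
    rw [this, smul_eq_mul, mul_inv_cancel_left₀ ht.ne', mul_zero, mul_one]
    rfl
  refine ContinuousOn.congr (f := fun t => t * ∫ θ in 0..1, heatP2 d (t * θ) (g (t - t * θ)) x) ?_ e
  refine continuousOn_id.mul ?_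
  intro t ht
  have ht' : 0 < t := ht
  refine ContinuousAt.continuousWithinAt ?_
  have hK : ∀ s r : ℝ, 0 < r → _ := fun s r hr => heatP2_bound (slice_cont hg s) (hB s) hα hC (hH s) hd hr x
  set K := C * N2 * (2 * d) ^ (α / 2 - 1) with hKdef
  have hK0 : 0 ≤ K := by have := N2_nonneg; positivity
  refine intervalIntegral.continuousAt_of_dominated_interval
    (bound := fun θ => K * (t / 2) ^ (α / 2 - 1) * θ ^ (α / 2 - 1)) ?_ ?_ ?_ ?_
  · filter_upwards [lt_mem_nhds ht'] with t1 ht1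
    rw [uIoc_of_le zero_le_one]
    refine ContinuousOn.aestronglyMeasurable ?_ measurableSet_Ioc
    refine (heatP2_contOn hd hg hB).comp (f := fun τ => (t1 - t1 * τ, t1 * τ, x)) (by fun_prop) ?_
    intro τ hτ
    exact mul_pos ht1 hτ.1
  · filter_upwards [lt_mem_nhds (half_lt_self ht')] with t1 ht1
    refine Eventually.of_forall fun θ hθ => ?_
    rw [uIoc_of_le zero_le_one] at hθ
    have hh : 0 < t1 := by linarith
    refine (hK _ _ (mul_pos hh hθ.1)).trans ?_
    rw [Real.mul_rpow hh.le hθ.1.le, ← mul_assoc]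
    have h2 : t1 ^ (α / 2 - 1) ≤ (t / 2) ^ (α / 2 - 1) :=
      Real.rpow_le_rpow_of_nonpos (by linarith) ht1.le (by linarith [hα.2])
    have h3 : 0 ≤ θ ^ (α / 2 - 1) := Real.rpow_nonneg hθ.1.le _
    exact mul_le_mul_of_nonneg_right (mul_le_mul_of_nonneg_left h2 hK0) h3
  · exact (intervalIntegral.intervalIntegrable_rpow' (by linarith [hα.1])).const_mul _
  · refine Eventually.of_forall fun θ hθ => ?_
    rw [uIoc_of_le zero_le_one] at hθ
    have h1 : ContinuousAt (fun q : ℝ × ℝ × ℝ => heatP2 d q.2.1 (g q.1) q.2.2) (t - t * θ, t * θ, x) := by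
      refine (heatP2_contOn hd hg hB).continuousAt ?_
      refine IsOpen.mem_nhds (isOpen_lt continuous_const (by fun_prop)) ?_
      exact mul_pos ht' hθ.1
    exact ContinuousAt.comp (f := fun t => (t - t * θ, t * θ, x)) h1 (by fun_prop)

theorem duh_formula (hd : 0 < d) (hg : Continuous fun q : ℝ × ℝ => g q.1 q.2)
    (hB : ∀ t x, |g t x| ≤ B) (hα : α ∈ Ioo (0:ℝ) 1)
    (hC : 0 ≤ C) (hH : ∀ t x y, |g t x - g t y| ≤ C * |x - y| ^ α) {t : ℝ} (ht : 0 ≤ t) (x : ℝ) :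
    duh d g t x = (∫ s in 0..t, g s x) + ∫ s in 0..t, d * duh2 d g s x := by
  have hβ : -1 < α / 2 - 1 := by linarith [hα.1]
  have hK : ∀ s r : ℝ, 0 < r → _ := fun s r hr => heatP2_bound (slice_cont hg s) (hB s) hα hC (hH s) hd hr x
  set K := C * N2 * (2 * d) ^ (α / 2 - 1) with hKdef
  have hb : ∀ r > 0, ∀ s, |d * heatP2 d r (g s) x| ≤ d * K * r ^ (α / 2 - 1) := by
    intro r hr s
    rw [abs_mul, abs_of_pos hd, mul_assoc]
    exact mul_le_mul_of_nonneg_left (hK _ _ hr) hd.le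
  have h1 : ∀ τ ≥ 0, ∀ s, ∫ r in 0..τ, d * heatP2 d r (g s) x = heatP d τ (g s) x - g s x := by
    intro τ hτ s
    have := intervalIntegral.integral_eq_sub_of_hasDerivAt_of_le (f := fun r => heatP d r (g s) x)
      (f' := fun r => d * heatP2 d r (g s) x) hτ ?_ ?_ ?_
    · rw [this, heatP_zero]
    · exact ((heatP_cont d hg hB).comp (f := fun τ => (s, τ, x)) (by fun_prop)).continuousOn
    · intro r hr
      exact heatP_hasDerivAt_t hd hr.1 (slice_cont hg _) (hB _) x
    · refine sing_integrable hβ hτ ?_ (fun r hr => hb r hr s)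
      refine continuousOn_const.mul ?_
      refine (heatP2_contOn hd hg hB).comp (f := fun τ => (s, τ, x)) (by fun_prop) ?_
      intro τ hτ; exact hτ
  have hcA : ∀ {φ : ℝ × ℝ → ℝ}, Continuous φ →
      ContinuousOn (fun q : ℝ × ℝ => d * heatP2 d q.1 (g (φ q)) x) {q | 0 < q.1} := by
    intro φ hφ
    refine continuousOn_const.mul ?_
    refine (heatP2_contOn hd hg hB).comp (f := fun q : ℝ × ℝ => (φ q, q.1, x)) (by fun_prop) ?_
    intro τ hτ; exact hτ
  have s1 := triangle_swap (A := fun r τ => d * heatP2 d r (g (t - τ)) x) hβ ht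
    (hcA (φ := fun q => t - q.2) (by fun_prop)) (fun r hr τ => hb r hr _)
  have s2 := triangle_swap (A := fun r s => d * heatP2 d r (g (s - r)) x) hβ ht
    (hcA (φ := fun q => q.2 - q.1) (by fun_prop)) (fun r hr τ => hb r hr _)
  have e1 : ∀ r, ∫ τ in r..t, d * heatP2 d r (g (t - τ)) x = ∫ σ in 0..(t - r), d * heatP2 d r (g σ) x := by
    intro r
    rw [intervalIntegral.integral_comp_sub_left (fun σ => d * heatP2 d r (g σ) x), sub_self]
  have e2 : ∀ r, ∫ τ in r..t, d * heatP2 d r (g (τ - r)) x = ∫ σ in 0..(t - r), d * heatP2 d r (g σ) x := by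
    intro r
    rw [intervalIntegral.integral_comp_sub_right (fun σ => d * heatP2 d r (g σ) x), sub_self]
  simp_rw [e1] at s1
  simp_rw [e2] at s2
  rw [← s2] at s1
  have e3 : ∫ τ in 0..t, ∫ r in 0..τ, d * heatP2 d r (g (t - τ)) x
      = ∫ τ in 0..t, (heatP d τ (g (t - τ)) x - g (t - τ) x) := by
    refine intervalIntegral.integral_congr fun τ hτ => ?_
    rw [uIcc_of_le ht] at hτ
    exact h1 τ hτ.1 _
  have hgx : Continuous fun s => g s x := hg.comp (by fun_prop : Continuous fun s : ℝ => (s, x))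
  rw [e3, intervalIntegral.integral_sub, intervalIntegral.integral_comp_sub_left (fun s => g s x)] at s1
  · rw [sub_self, sub_zero] at s1
    unfold duh
    rw [sub_eq_iff_eq_add] at s1
    rw [s1, add_comm]
    congr 1
    refine intervalIntegral.integral_congr fun τ hτ => ?_
    simp only [duh2, intervalIntegral.integral_const_mul]
  · exact ((heatP_cont d hg hB).comp (f := fun τ => (t - τ, τ, x)) (by fun_prop)).intervalIntegrable _ _
  · exact (hgx.comp (by fun_prop : Continuous fun τ => t - τ)).intervalIntegrable _ _

theorem duh_heatOp (hd : 0 < d) (hg : Continuous fun q : ℝ × ℝ => g q.1 q.2)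
    (hB : ∀ t x, |g t x| ≤ B) (hα : α ∈ Ioo (0:ℝ) 1)
    (hC : 0 ≤ C) (hH : ∀ t x y, |g t x - g t y| ≤ C * |x - y| ^ α) :
    HeatOp d (duh d g) g := by
  intro t ht x
  have e : deriv (duh d g t) = duh1 d g t := funext fun x => (duh_hasDerivAt_x hd hg hB ht.le x).deriv
  have h2 := duh1_hasDerivAt_x hd hg hB hα hC hH ht.le x
  refine ⟨(duh_hasDerivAt_x hd hg hB ht.le x).differentiableAt, ?_, ?_⟩
  · rw [e]; exact h2.differentiableAt
  · rw [e, h2.deriv]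
    have hgx : Continuous fun s => g s x := hg.comp (by fun_prop : Continuous fun s : ℝ => (s, x))
    have a1 : HasDerivAt (fun t => ∫ s in 0..t, g s x) (g t x) t :=
      intervalIntegral.integral_hasDerivAt_right (hgx.intervalIntegrable _ _)
        (hgx.stronglyMeasurableAtFilter _ _) hgx.continuousAt
    have c2 : ContinuousOn (fun s => d * duh2 d g s x) (Ioi 0) :=
      continuousOn_const.mul (duh2_cont hd hg hB hα hC hH x)
    have hβ : -1 < α / 2 - 1 := by linarith [hα.1]
    have a2 : HasDerivAt (fun t => ∫ s in 0..t, d * duh2 d g s x) (d * duh2 d g t x) t := by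
      refine intervalIntegral.integral_hasDerivAt_right ?_
        (c2.stronglyMeasurableAtFilter isOpen_Ioi t ht) (c2.continuousAt (Ioi_mem_nhds ht))
      refine sing_integrable (β := α / 2 - 1 + 1)
        (C := d * ((C * N2 * (2 * d) ^ (α / 2 - 1)) / (α / 2 - 1 + 1))) (by linarith [hα.1]) ht.le c2 ?_
      intro r hr
      rw [abs_mul, abs_of_pos hd, mul_assoc]
      refine mul_le_mul_of_nonneg_left ?_ hd.le
      exact sing_bound hβ hr.le
        (fun τ hτ => heatP2_bound (slice_cont hg _) (hB _) hα hC (hH _) hd hτ x)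
    have a3 := (a1.add a2).congr_of_eventuallyEq (f₁ := fun s => duh d g s x) (by
      filter_upwards [lt_mem_nhds ht] with s hs
      exact duh_formula hd hg hB hα hC hH hs.le x)
    rw [add_comm]
    exact a3
end

open MeasureTheory

theorem heatP_sub_bound {G G' : ℝ → ℝ} (hG : Continuous G) (hG' : Continuous G') {B B' D : ℝ}
    (hB : ∀ x, |G x| ≤ B) (hB' : ∀ x, |G' x| ≤ B') (hD : ∀ x, |G x - G' x| ≤ D) (d τ x : ℝ) :
    |heatP d τ G x - heatP d τ G' x| ≤ D := by
  have e : heatP d τ G x - heatP d τ G' x = heatP d τ (fun x => G x - G' x) x := by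
    unfold heatP JJ
    rw [← integral_sub (Wt0.integrable_mul hG hB _ _) (Wt0.integrable_mul hG' hB' _ _)]
    congr 1
    funext y
    ring
  rw [e]
  exact heatP_bound hD d τ x

theorem heatP_const_mul (d τ c : ℝ) (G : ℝ → ℝ) (x : ℝ) :
    heatP d τ (fun y => c * G y) x = c * heatP d τ G x := by
  unfold heatP JJ
  rw [← integral_const_mul]
  congr 1
  funext y
  ring

theorem heatP_lip {G : ℝ → ℝ} (hG : Continuous G) {B K : ℝ}
    (hB : ∀ x, |G x| ≤ B) (hK : ∀ x y, |G x - G y| ≤ K * |x - y|) (d τ x y : ℝ) :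
    |heatP d τ G x - heatP d τ G y| ≤ K * |x - y| := by
  have e : heatP d τ G y = heatP d τ (fun z => G (z + (y - x))) x := by
    unfold heatP JJ
    congr 1
    funext z
    congr 2
    ring
  rw [e]
  refine heatP_sub_bound hG (hG.comp (by fun_prop)) hB (fun z => hB _) (fun z => ?_) d τ x
  refine (hK _ _).trans (le_of_eq ?_)
  congr 2
  ring

theorem exp_int_le {l t : ℝ} (hl : 0 < l) : ∫ τ in 0..t, Real.exp (-l * τ) ≤ 1 / l := by
  have h := intervalIntegral.integral_eq_sub_of_hasDerivAt (a := 0) (b := t)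
    (f := fun τ => - (Real.exp (-l * τ) / l)) (f' := fun τ => Real.exp (-l * τ)) ?_ ?_
  · rw [h]
    simp
    positivity
  · intro τ _
    have := ((((hasDerivAt_id τ).const_mul (-l)).exp).div_const l).neg
    convert! this using 1
    simp
    field_simp
  · exact Continuous.intervalIntegrable (by fun_prop) _ _

section
variable {d : ℝ} {F : ℝ → ℝ → ℝ → ℝ} {Λ B l : ℝ} {u0 : ℝ → ℝ}

open BoundedContinuousFunction in
theorem picard (hd : 0 < d)
    (hF : Continuous fun q : ℝ × ℝ × ℝ => F q.1 q.2.1 q.2.2) (hΛ : 0 ≤ Λ)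
    (hLip : ∀ t x u v, |F t x u - F t x v| ≤ Λ * |u - v|) (hB : ∀ t x, |F t x 0| ≤ B)
    (hu0 : Continuous u0) {B0 : ℝ} (hB0 : ∀ x, |u0 x| ≤ B0) (hl : 0 < l) (hl2 : 2 * Λ ≤ l) :
    ∃ (U : ℝ → ℝ → ℝ) (N : ℝ), (Continuous fun q : ℝ × ℝ => U q.1 q.2) ∧ (∀ t x, |U t x| ≤ N) ∧
      ∀ t ≥ 0, ∀ x, U t x = Real.exp (-l * t) * heatP d t u0 x +
        ∫ τ in 0..t, Real.exp (-l * τ) * heatP d τ (fun y => Real.exp (-l * max (t - τ) 0) *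
          F (max (t - τ) 0) y (Real.exp (l * max (t - τ) 0) * U (t - τ) y)) x := by
  have hBn : 0 ≤ B := (abs_nonneg _).trans (hB 0 0)
  have hB0n : 0 ≤ B0 := (abs_nonneg _).trans (hB0 0)
  let GG : (ℝ → ℝ → ℝ) → ℝ → ℝ → ℝ := fun U s y => Real.exp (-l * max s 0) *
          F (max s 0) y (Real.exp (l * max s 0) * U s y)
  have GGc : ∀ U : ℝ → ℝ → ℝ, (Continuous fun q : ℝ × ℝ => U q.1 q.2) →
      Continuous fun q : ℝ × ℝ => GG U q.1 q.2 := by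
    intro U hU
    have : Continuous fun q : ℝ × ℝ => F (max q.1 0) q.2 (Real.exp (l * max q.1 0) * U q.1 q.2) :=
      hF.comp (f := fun q : ℝ × ℝ => (max q.1 0, q.2, Real.exp (l * max q.1 0) * U q.1 q.2)) (by fun_prop)
    exact Continuous.mul (by fun_prop) this
  have ee : ∀ s : ℝ, Real.exp (-l * s) * Real.exp (l * s) = 1 := by
    intro s
    rw [← Real.exp_add]
    simp
  have GGd : ∀ U V : ℝ → ℝ → ℝ, ∀ s y, |GG U s y - GG V s y| ≤ Λ * |U s y - V s y| := by
    intro U V s y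
    simp only [GG]
    rw [← mul_sub, abs_mul, abs_of_pos (Real.exp_pos _)]
    have := hLip (max s 0) y (Real.exp (l * max s 0) * U s y) (Real.exp (l * max s 0) * V s y)
    rw [← mul_sub, abs_mul, abs_of_pos (Real.exp_pos _)] at this
    calc _ ≤ Real.exp (-l * max s 0) * (Λ * (Real.exp (l * max s 0) * |U s y - V s y|)) :=
          mul_le_mul_of_nonneg_left this (Real.exp_pos _).le
      _ = (Real.exp (-l * max s 0) * Real.exp (l * max s 0)) * (Λ * |U s y - V s y|) := by ring
      _ = _ := by rw [ee, one_mul]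
  have GG0 : ∀ s y, |GG (fun _ _ => 0) s y| ≤ B := by
    intro s y
    simp only [GG, mul_zero]
    rw [abs_mul, abs_of_pos (Real.exp_pos _)]
    have h1 : Real.exp (-l * max s 0) ≤ 1 := by
      rw [Real.exp_le_one_iff]
      have := mul_nonneg hl.le (le_max_right s 0)
      linarith
    calc _ ≤ 1 * B := mul_le_mul h1 (hB _ _) (abs_nonneg _) zero_le_one
      _ = B := one_mul B
  have GGb : ∀ U : ℝ → ℝ → ℝ, ∀ N, (∀ t x, |U t x| ≤ N) → ∀ s y, |GG U s y| ≤ B + Λ * N := by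
    intro U N hN s y
    have h1 := GGd U (fun _ _ => 0) s y
    rw [sub_zero] at h1
    have h2 := abs_sub_abs_le_abs_sub (GG U s y) (GG (fun _ _ => 0) s y)
    have h3 := mul_le_mul_of_nonneg_left (hN s y) hΛ
    linarith [GG0 s y]
  let Q : (ℝ → ℝ → ℝ) → ℝ × ℝ → ℝ := fun U q => 
      Real.exp (-l * max q.1 0) * heatP d (max q.1 0) u0 q.2 +
        ∫ τ in 0..(max q.1 0), Real.exp (-l * τ) * heatP d τ (GG U (max q.1 0 - τ)) q.2
  have Ic : ∀ U : ℝ → ℝ → ℝ, (Continuous fun q : ℝ × ℝ => U q.1 q.2) → ∀ N, (∀ t x, |U t x| ≤ N) →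
      Continuous fun q : (ℝ × ℝ) × ℝ => Real.exp (-l * q.2) * heatP d q.2 (GG U (max q.1.1 0 - q.2)) q.1.2 := by
    intro U hU N hN
    refine Continuous.mul (by fun_prop) ?_
    exact (heatP_cont d (GGc U hU) (GGb U N hN)).comp
      (f := fun q : (ℝ × ℝ) × ℝ => (max q.1.1 0 - q.2, q.2, q.1.2)) (by fun_prop)
  have Qc : ∀ U : ℝ → ℝ → ℝ, (Continuous fun q : ℝ × ℝ => U q.1 q.2) → ∀ N, (∀ t x, |U t x| ≤ N) →
      Continuous (Q U) := by
    intro U hU N hN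
    refine Continuous.add (Continuous.mul (by fun_prop) ?_) ?_
    · exact (heatP_cont d (g := fun _ => u0) (by fun_prop) (fun _ => hB0)).comp
        (f := fun q : ℝ × ℝ => (0, max q.1 0, q.2)) (by fun_prop)
    · exact intervalIntegral.continuous_parametric_intervalIntegral_of_continuous
        (f := fun (q : ℝ × ℝ) τ => Real.exp (-l * τ) * heatP d τ (GG U (max q.1 0 - τ)) q.2)
        (s := fun q => max q.1 0) (Ic U hU N hN) (by fun_prop)
  have eint : ∀ (A : ℝ → ℝ) (D t : ℝ), 0 ≤ t → 0 ≤ D → (∀ τ, |A τ| ≤ Real.exp (-l * τ) * D) →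
      |∫ τ in 0..t, A τ| ≤ D / l := by
    intro A D t ht hD hA
    have := intervalIntegral.norm_integral_le_of_norm_le (f := A)
      (g := fun τ => Real.exp (-l * τ) * D) (μ := volume) ht (Eventually.of_forall fun q hq => hA q)
      (Continuous.intervalIntegrable (by fun_prop) _ _)
    rw [intervalIntegral.integral_mul_const] at this
    calc _ ≤ _ := this
      _ ≤ (1 / l) * D := mul_le_mul_of_nonneg_right (exp_int_le hl) hD
      _ = _ := by ring
  have Qb : ∀ U : ℝ → ℝ → ℝ, (Continuous fun q : ℝ × ℝ => U q.1 q.2) → ∀ N, 0 ≤ N → (∀ t x, |U t x| ≤ N) →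
      ∀ q, ‖Q U q‖ ≤ B0 + (B + Λ * N) / l := by
    intro U hU N hN0 hN q
    refine (norm_add_le _ _).trans (add_le_add ?_ ?_)
    · rw [Real.norm_eq_abs, abs_mul, abs_of_pos (Real.exp_pos _)]
      have h1 : Real.exp (-l * max q.1 0) ≤ 1 := by
        rw [Real.exp_le_one_iff]
        have := mul_nonneg hl.le (le_max_right q.1 0)
        linarith
      calc _ ≤ 1 * B0 := mul_le_mul h1 (heatP_bound hB0 _ _ _) (abs_nonneg _) zero_le_one
        _ = B0 := one_mul _
    · refine eint _ _ _ (le_max_right _ _) (by positivity) fun τ => ?_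
      rw [abs_mul, abs_of_pos (Real.exp_pos _)]
      exact mul_le_mul_of_nonneg_left (heatP_bound (GGb U N hN _) _ _ _) (Real.exp_pos _).le
  have hUc : ∀ U : (ℝ × ℝ) →ᵇ ℝ, Continuous fun q : ℝ × ℝ => (fun t x => U (t, x)) q.1 q.2 :=
    fun U => U.continuous
  have hUb : ∀ U : (ℝ × ℝ) →ᵇ ℝ, ∀ t x, |(fun t x => U (t, x)) t x| ≤ ‖U‖ :=
    fun U t x => U.norm_coe_le_norm (t, x)
  obtain ⟨Ψ, hΨ⟩ : ∃ Ψ : ((ℝ × ℝ) →ᵇ ℝ) → ((ℝ × ℝ) →ᵇ ℝ), ∀ U q, Ψ U q = Q (fun t x => U (t, x)) q :=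
    ⟨fun U => BoundedContinuousFunction.ofNormedAddCommGroup (Q fun t x => U (t, x))
      (Qc _ (hUc U) _ (hUb U)) _ (Qb _ (hUc U) _ (norm_nonneg U) (hUb U)), fun _ _ => rfl⟩
  have hcontr : ContractingWith (1/2) Ψ := by
    refine ⟨by norm_num, LipschitzWith.of_dist_le_mul fun U V => ?_⟩
    rw [BoundedContinuousFunction.dist_le (by positivity)]
    intro q
    rw [hΨ, hΨ, Real.dist_eq]
    simp only [Q]
    rw [add_sub_add_left_eq_sub, ← intervalIntegral.integral_sub]
    · refine (eint _ (Λ * dist U V) _ (le_max_right _ _) (by positivity) fun τ => ?_).trans ?_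
      · rw [← mul_sub, abs_mul, abs_of_pos (Real.exp_pos _)]
        refine mul_le_mul_of_nonneg_left ?_ (Real.exp_pos _).le
        refine heatP_sub_bound (slice_cont (GGc (fun t x => U (t, x)) (hUc U)) _)
          (slice_cont (GGc (fun t x => V (t, x)) (hUc V)) _)
          (GGb (fun t x => U (t, x)) _ (hUb U) _) (GGb (fun t x => V (t, x)) _ (hUb V) _) (fun y => ?_) d τ q.2
        refine (GGd (fun t x => U (t, x)) (fun t x => V (t, x)) _ _).trans (mul_le_mul_of_nonneg_left ?_ hΛ)
        exact BoundedContinuousFunction.dist_coe_le_dist (f := U) (g := V) (max q.1 0 - τ, y)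
      · rw [div_le_iff₀ hl]
        push_cast
        nlinarith [dist_nonneg (x := U) (y := V)]
    · exact ((Ic _ (hUc U) _ (hUb U)).comp (by fun_prop : Continuous fun τ : ℝ => (q, τ))).intervalIntegrable _ _
    · exact ((Ic _ (hUc V) _ (hUb V)).comp (by fun_prop : Continuous fun τ : ℝ => (q, τ))).intervalIntegrable _ _
  obtain ⟨U, hfix⟩ : ∃ U, Ψ U = U := ⟨_, hcontr.fixedPoint_isFixedPt⟩
  refine ⟨fun t x => U (t, x), ‖U‖, hUc U, hUb U, fun t ht x => ?_⟩
  have h1 : U (t, x) = Q (fun t x => U (t, x)) (t, x) := by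
    rw [← hΨ, hfix]
  show U (t, x) = _
  rw [h1]
  simp only [Q, max_eq_left ht]
  rfl

theorem exists_sol {α : ℝ} (hd : 0 < d)
    (hF : Continuous fun q : ℝ × ℝ × ℝ => F q.1 q.2.1 q.2.2) (hΛ : 0 ≤ Λ)
    (hLip : ∀ t x u v, |F t x u - F t x v| ≤ Λ * |u - v|) (hB : ∀ t x, |F t x 0| ≤ B)
    (hα : α ∈ Ioo (0:ℝ) 1)
    (hH : ∀ R, ∃ C, 0 ≤ C ∧ ∀ t x y u, |u| ≤ R → |F t x u - F t y u| ≤ C * |x - y| ^ α)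
    {B0 K0 : ℝ} (hB0 : ∀ x, |u0 x| ≤ B0) (hK0 : 0 ≤ K0) (hL0 : ∀ x y, |u0 x - u0 y| ≤ K0 * |x - y|) :
    ∃ u : ℝ → ℝ → ℝ, (Continuous fun q : ℝ × ℝ => u q.1 q.2) ∧ (∀ x, u 0 x = u0 x) ∧
      HeatOp d u (fun t x => F t x (u t x)) ∧
      (∀ T, ∃ R, ∀ t, 0 ≤ t → t ≤ T → ∀ x, |u t x| ≤ R) ∧
      (∀ T, ∃ K, 0 ≤ K ∧ ∀ t, 0 ≤ t → t ≤ T → ∀ x y, |u t x - u t y| ≤ K * |x - y|) := by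
  have hu0 : Continuous u0 := by
    refine (LipschitzWith.of_dist_le_mul (K := ⟨K0, hK0⟩) fun x y => ?_).continuous
    exact hL0 x y
  have hBn : 0 ≤ B := (abs_nonneg _).trans (hB 0 0)
  obtain ⟨U, N, hUc, hUb, hU⟩ := picard (l := 2 * Λ + 1) hd hF hΛ hLip hB hu0 hB0
    (by positivity) (by linarith)
  set l := 2 * Λ + 1 with hl
  have hl0 : 0 ≤ l := by positivity
  have hN : 0 ≤ N := (abs_nonneg _).trans (hUb 0 0)
  set u : ℝ → ℝ → ℝ := fun t x => Real.exp (l * t) * U t x with hu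
  have huc : Continuous fun q : ℝ × ℝ => u q.1 q.2 := Continuous.mul (by fun_prop) hUc
  have hub : ∀ T, ∀ t, t ≤ T → ∀ x, |u t x| ≤ Real.exp (l * T) * N := by
    intro T t htT x
    simp only [hu]
    rw [abs_mul, abs_of_pos (Real.exp_pos _)]
    refine mul_le_mul ?_ (hUb t x) (abs_nonneg _) (Real.exp_pos _).le
    exact Real.exp_le_exp.2 (mul_le_mul_of_nonneg_left htT hl0)
  let gT : ℝ → ℝ → ℝ → ℝ := fun T s x => F (max 0 (min s T)) x (u (max 0 (min s T)) x)
  have gTc : ∀ T, Continuous fun q : ℝ × ℝ => gT T q.1 q.2 := by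
    intro T
    have h1 : Continuous fun q : ℝ × ℝ => u (max 0 (min q.1 T)) q.2 :=
      huc.comp (f := fun q : ℝ × ℝ => (max 0 (min q.1 T), q.2)) (by fun_prop)
    exact hF.comp (f := fun q : ℝ × ℝ => (max 0 (min q.1 T), q.2, u (max 0 (min q.1 T)) q.2)) (by fun_prop)
  have gTb : ∀ T ≥ 0, ∀ s x, |gT T s x| ≤ B + Λ * (Real.exp (l * T) * N) := by
    intro T hT s x
    have h1 := hLip (max 0 (min s T)) x (u (max 0 (min s T)) x) 0
    rw [sub_zero] at h1
    have h2 := abs_sub_abs_le_abs_sub (F (max 0 (min s T)) x (u (max 0 (min s T)) x)) (F (max 0 (min s T)) x 0)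
    have h3 := mul_le_mul_of_nonneg_left (hub T (max 0 (min s T)) (max_le hT (min_le_right _ _)) x) hΛ
    have h4 := hB (max 0 (min s T)) x
    show |F (max 0 (min s T)) x (u (max 0 (min s T)) x)| ≤ _
    linarith
  have rep : ∀ T, ∀ t, 0 ≤ t → t ≤ T → ∀ x, u t x = heatP d t u0 x + duh d (gT T) t x := by
    intro T t ht htT x
    have ee : ∀ s : ℝ, Real.exp (l * s) * Real.exp (-l * s) = 1 := by
      intro s
      rw [← Real.exp_add]
      simp
    show Real.exp (l * t) * U t x = _
    rw [hU t ht x, mul_add, ← mul_assoc, ee, one_mul]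
    congr 1
    unfold duh
    rw [← intervalIntegral.integral_const_mul]
    refine intervalIntegral.integral_congr fun τ hτ => ?_
    rw [uIcc_of_le ht] at hτ
    have h1 : max (t - τ) 0 = t - τ := max_eq_left (by linarith [hτ.2])
    have h2 : max 0 (min (t - τ) T) = t - τ := by
      rw [min_eq_left (by linarith [hτ.1]), max_eq_right (by linarith [hτ.2])]
    simp only [gT, h1, h2, hu]
    rw [heatP_const_mul, ← mul_assoc, ← mul_assoc, ← Real.exp_add, ← Real.exp_add]
    rw [show l * t + -l * τ + -l * (t - τ) = 0 by ring, Real.exp_zero, one_mul]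
  have hlip : ∀ T, ∃ K, 0 ≤ K ∧ ∀ t, 0 ≤ t → t ≤ T → ∀ x y, |u t x - u t y| ≤ K * |x - y| := by
    intro T
    rcases lt_or_ge T 0 with hT | hT
    · exact ⟨0, le_rfl, fun t h1 h2 => by linarith⟩
    set M := ((B + Λ * (Real.exp (l * T) * N)) * (∫ y, |y * gphi y|) * (2 * d) ^ (-(1/2) : ℝ)) / (-(1/2) + 1) with hM
    have hI : 0 ≤ ∫ y, |y * gphi y| := integral_nonneg fun _ => abs_nonneg _
    have hM0 : 0 ≤ M := by
      refine div_nonneg ?_ (by norm_num)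
      positivity
    refine ⟨K0 + M * T ^ (-(1/2) + 1 : ℝ), by positivity, fun t h1 h2 x y => ?_⟩
    rw [rep T t h1 h2 x, rep T t h1 h2 y, add_mul]
    rw [add_sub_add_comm]
    refine (abs_add_le _ _).trans (add_le_add (heatP_lip hu0 hB0 hL0 d t x y) ?_)
    have := Convex.norm_image_sub_le_of_norm_hasDerivWithin_le (f := duh d (gT T) t) (f' := duh1 d (gT T) t)
      (s := univ) (x := y) (y := x) (C := M * T ^ (-(1/2) + 1 : ℝ)) (fun z _ => 
        (duh_hasDerivAt_x hd (gTc T) (gTb T hT) h1 z).hasDerivWithinAt) (fun z _ => ?_) convex_univ trivial trivial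
    · exact this
    · refine (duh1_bound hd (gTb T hT) h1 z).trans ?_
      refine mul_le_mul_of_nonneg_left ?_ hM0
      exact Real.rpow_le_rpow h1 h2 (by norm_num)
  refine ⟨u, huc, ?_, ?_, ?_, hlip⟩
  · intro x
    rw [rep 0 0 le_rfl le_rfl, heatP_zero]
    simp [duh]
  · intro t ht x
    have hT : (0:ℝ) ≤ t + 1 := by linarith
    obtain ⟨K, hK0, hK⟩ := hlip (t + 1)
    obtain ⟨C, hC0, hC⟩ := hH (Real.exp (l * (t + 1)) * N)
    set R := Real.exp (l * (t + 1)) * N with hR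
    have hR0 : 0 ≤ R := by positivity
    have gTH : ∀ s x y, |gT (t + 1) s x - gT (t + 1) s y| ≤ (C + Λ * (K + 2 * R)) * |x - y| ^ α := by
      intro s x y
      have hs1 : 0 ≤ max 0 (min s (t + 1)) := le_max_left _ _
      have hs2 : max 0 (min s (t + 1)) ≤ t + 1 := max_le hT (min_le_right _ _)
      simp only [gT]
      set σ := max 0 (min s (t + 1))
      have h1 := hC σ x y (u σ x) (hub _ _ hs2 x)
      have h2 := hLip σ y (u σ x) (u σ y)
      have h3 : |u σ x - u σ y| ≤ (K + 2 * R) * |x - y| ^ α := by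
        rcases le_total |x - y| 1 with h | h
        · have h4 : |x - y| ≤ |x - y| ^ α := by
            have := Real.rpow_le_rpow_of_exponent_ge' (abs_nonneg (x - y)) h hα.1.le hα.2.le
            rwa [Real.rpow_one] at this
          have h5 := mul_le_mul_of_nonneg_left h4 hK0
          have h6 : 0 ≤ 2 * R * |x - y| ^ α := by positivity
          have := hK σ hs1 hs2 x y
          linarith
        · have h4 : 1 ≤ |x - y| ^ α := Real.one_le_rpow h hα.1.le
          have h5 : |u σ x - u σ y| ≤ 2 * R := by
            have a := abs_le.1 (hub _ _ hs2 x)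
            have b := abs_le.1 (hub _ _ hs2 y)
            rw [abs_le]
            constructor <;> linarith [a.1, a.2, b.1, b.2]
          nlinarith
      have h4 := mul_le_mul_of_nonneg_left h3 hΛ
      have h5 := abs_sub_le (F σ x (u σ x)) (F σ y (u σ x)) (F σ y (u σ y))
      nlinarith
    have hop := (heatP_heatOp hd hu0 hB0).add (duh_heatOp hd (gTc (t + 1)) (gTb (t + 1) hT) hα
      (by positivity) gTH)
    obtain ⟨a1, a2, a3⟩ := hop t ht x
    have e : (fun x => heatP d t u0 x + duh d (gT (t + 1)) t x) = u t :=
      funext fun x => (rep (t + 1) t ht.le (by linarith) x).symm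
    have e2 : gT (t + 1) t x = F t x (u t x) := by
      simp only [gT]
      rw [min_eq_left (by linarith), max_eq_right ht.le]
    simp only [e, zero_add, e2] at a1 a2 a3
    refine ⟨a1, a2, a3.congr_of_eventuallyEq ?_⟩
    filter_upwards [lt_mem_nhds ht, gt_mem_nhds (lt_add_one t)] with s hs1 hs2
    exact rep (t + 1) s hs1.le hs2.le x
  · intro T
    exact ⟨_, fun t _ h2 x => hub T t h2 x⟩
end

open MeasureTheory

structure LinSol (d : ℝ) (b q : ℝ → ℝ → ℝ) : Prop where
  op : HeatOp d q (fun t x => b t x * q t x)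
  cont : Continuous fun z : ℝ × ℝ => q z.1 z.2
  bdd : ∀ T, ∃ R, ∀ t, 0 ≤ t → t ≤ T → ∀ x, |q t x| ≤ R

theorem LinSol.const_mul {d : ℝ} {b q : ℝ → ℝ → ℝ} (h : LinSol d b q) (c : ℝ) :
    LinSol d b (fun t x => c * q t x) := by
  refine ⟨(h.op.const_mul c).congr fun t _ x => by ring, continuous_const.mul h.cont, fun T => ?_⟩
  obtain ⟨R, hR⟩ := h.bdd T
  refine ⟨|c| * R, fun t h1 h2 x => ?_⟩
  rw [abs_mul]
  exact mul_le_mul_of_nonneg_left (hR t h1 h2 x) (abs_nonneg _)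

theorem LinSol.add {d : ℝ} {b q q' : ℝ → ℝ → ℝ} (h : LinSol d b q) (h' : LinSol d b q') :
    LinSol d b (fun t x => q t x + q' t x) := by
  refine ⟨(h.op.add h'.op).congr fun t _ x => by ring, h.cont.add h'.cont, fun T => ?_⟩
  obtain ⟨R, hR⟩ := h.bdd T
  obtain ⟨R', hR'⟩ := h'.bdd T
  exact ⟨R + R', fun t h1 h2 x => (abs_add_le _ _).trans (add_le_add (hR t h1 h2 x) (hR' t h1 h2 x))⟩

theorem LinSol.sub {d : ℝ} {b q q' : ℝ → ℝ → ℝ} (h : LinSol d b q) (h' : LinSol d b q') :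
    LinSol d b (fun t x => q t x - q' t x) := by
  have := h.add (h'.const_mul (-1))
  convert! this using 3
  ring

theorem LinSol.translate {d a : ℝ} {b q : ℝ → ℝ → ℝ} (h : LinSol d b q)
    (hb : ∀ t x, b t (x + a) = b t x) : LinSol d b (fun t x => q t (x + a)) := by
  refine ⟨(h.op.translate a).congr fun t _ x => by rw [hb], ?_, fun T => ?_⟩
  · exact h.cont.comp (f := fun z : ℝ × ℝ => (z.1, z.2 + a)) (by fun_prop)
  · obtain ⟨R, hR⟩ := h.bdd T
    exact ⟨R, fun t h1 h2 x => hR t h1 h2 _⟩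

theorem LinSol.shift {d a : ℝ} {b q : ℝ → ℝ → ℝ} (h : LinSol d b q) (ha : 0 ≤ a) :
    LinSol d (fun t x => b (t + a) x) (fun t x => q (t + a) x) := by
  refine ⟨h.op.shift a ha, ?_, fun T => ?_⟩
  · exact h.cont.comp (f := fun z : ℝ × ℝ => (z.1 + a, z.2)) (by fun_prop)
  · obtain ⟨R, hR⟩ := h.bdd (T + a)
    exact ⟨R, fun t h1 h2 x => hR (t + a) (by linarith) (by linarith) _⟩

theorem LinSol.nonneg {d C : ℝ} (hd : 0 < d) {b q : ℝ → ℝ → ℝ} (h : LinSol d b q)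
    (hb : ∀ t x, |b t x| ≤ C) (h0 : ∀ x, 0 ≤ q 0 x) : ∀ t ≥ 0, ∀ x, 0 ≤ q t x := by
  have h1 := h.const_mul (-1)
  have := max_principle hd.le h1.op h1.cont.continuousOn (fun T => ?_) (fun x => ?_) C ?_
  · intro t ht x
    linarith [this t ht x]
  · obtain ⟨R, hR⟩ := h1.bdd T
    exact ⟨R, fun t a b x => (le_abs_self _).trans (hR t a b x)⟩
  · linarith [h0 x]
  · intro t _ x hz
    exact mul_le_mul_of_nonneg_right ((le_abs_self _).trans (hb t x)) hz.le

theorem LinSol.lower {d C : ℝ} (hd : 0 < d) {b q : ℝ → ℝ → ℝ} (h : LinSol d b q)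
    (hb : ∀ t x, |b t x| ≤ C) (h0 : ∀ x, 0 ≤ q 0 x) (t : ℝ) (ht : 0 ≤ t) (x : ℝ) :
    Real.exp (-C * t) * heatP d t (q 0) x ≤ q t x := by
  obtain ⟨R0, hR0⟩ := h.bdd 0
  have hB : ∀ x, |q 0 x| ≤ R0 := hR0 0 le_rfl le_rfl
  have hc := slice_cont h.cont 0
  have hnn := h.nonneg hd hb h0
  have hP := ((heatP_heatOp hd hc hB).exp_mul (-C)).sub h.op
  have hPc : Continuous fun z : ℝ × ℝ => heatP d z.1 (q 0) z.2 :=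
    (heatP_cont d (g := fun _ => q 0) (by fun_prop) (fun _ => hB)).comp
        (f := fun q : ℝ × ℝ => (0, q.1, q.2)) (by fun_prop)
  have hC : 0 ≤ C := (abs_nonneg _).trans (hb 0 0)
  have := max_principle hd.le hP ?_ ?_ ?_ (-C) ?_ t ht x
  · linarith
  · exact (Continuous.sub (Continuous.mul (by fun_prop) hPc) h.cont).continuousOn
  · intro T
    refine ⟨R0, fun t h1 h2 x => ?_⟩
    have e1 : Real.exp (-C * t) ≤ 1 := by
      rw [Real.exp_le_one_iff]; nlinarith
    have e2 := (le_abs_self _).trans (heatP_bound hB d t x)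
    have e3 : 0 ≤ R0 := (abs_nonneg _).trans (hB 0)
    nlinarith [hnn t h1 x, Real.exp_pos (-C * t)]
  · intro x
    simp [heatP_zero]
  · intro t ht x hz
    have := (abs_le.1 (hb t x)).1
    nlinarith [hnn t ht.le x]

theorem LinSol.upper {d C : ℝ} (hd : 0 < d) {b q : ℝ → ℝ → ℝ} (h : LinSol d b q)
    (hb : ∀ t x, |b t x| ≤ C) (h0 : ∀ x, 0 ≤ q 0 x) (t : ℝ) (ht : 0 ≤ t) (x : ℝ) :
    q t x ≤ Real.exp (C * t) * heatP d t (q 0) x := by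
  obtain ⟨R0, hR0⟩ := h.bdd 0
  have hB : ∀ x, |q 0 x| ≤ R0 := hR0 0 le_rfl le_rfl
  have hc := slice_cont h.cont 0
  have hnn := h.nonneg hd hb h0
  have hP := h.op.sub ((heatP_heatOp hd hc hB).exp_mul C)
  have hPc : Continuous fun z : ℝ × ℝ => heatP d z.1 (q 0) z.2 :=
    (heatP_cont d (g := fun _ => q 0) (by fun_prop) (fun _ => hB)).comp
        (f := fun q : ℝ × ℝ => (0, q.1, q.2)) (by fun_prop)
  have hP0 : ∀ t x, 0 ≤ heatP d t (q 0) x := fun t x =>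
    integral_nonneg fun y => mul_nonneg (h0 _) (gphi_pos y).le
  have := max_principle hd.le hP ?_ ?_ ?_ C ?_ t ht x
  · linarith
  · exact (Continuous.sub h.cont (Continuous.mul (by fun_prop) hPc)).continuousOn
  · intro T
    obtain ⟨R, hR⟩ := h.bdd T
    refine ⟨R, fun t h1 h2 x => ?_⟩
    have := (le_abs_self _).trans (hR t h1 h2 x)
    have := mul_nonneg (Real.exp_pos (C * t)).le (hP0 t x)
    linarith
  · intro x
    simp [heatP_zero]
  · intro t ht x hz
    have := (abs_le.1 (hb t x)).2
    nlinarith [hnn t ht.le x]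

theorem kernel_harnack {d ρ a A : ℝ} (hd : 0 < d) (hρ : 0 < ρ) (ha : |a| ≤ A) {G : ℝ → ℝ}
    (hG : Continuous G) (hG0 : ∀ x, 0 ≤ G x) {B : ℝ} (hB : ∀ x, |G x| ≤ B) (x : ℝ) :
    Real.exp (-(A ^ 2 / (4 * d * ρ))) / Real.sqrt 2 * heatP d ρ G (x + a) ≤ heatP d (2 * ρ) G x := by
  have hs := sg_pos hd hρ
  have h2 : 0 < Real.sqrt 2 := by positivity
  have e2 : sg d (2 * ρ) = Real.sqrt 2 * sg d ρ := by
    unfold sg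
    rw [← Real.sqrt_mul (by norm_num)]
    congr 1
    ring
  set s := sg d ρ with hsdef
  have hss : s ^ 2 = 2 * d * ρ := sg_sq hd hρ.le
  have e3 : heatP d (2 * ρ) G x = (Real.sqrt 2)⁻¹ * ∫ y, G (x + a + s * y) * gphi ((Real.sqrt 2)⁻¹ * (y + a / s)) := by
    unfold heatP JJ
    rw [e2]
    have := Measure.integral_comp_mul_left (fun y => G (x + Real.sqrt 2 * s * y) * gphi y) (Real.sqrt 2)⁻¹
    rw [inv_inv, abs_of_pos h2, smul_eq_mul] at this
    rw [← integral_add_right_eq_self _ (a / s)] at this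
    rw [← inv_mul_eq_iff_eq_mul₀ h2.ne'] at this
    rw [← this]
    congr 2
    funext y
    congr 2
    field_simp
    ring
  rw [e3]
  unfold heatP JJ
  rw [← integral_const_mul, ← integral_const_mul]
  have hk : Wt fun y => (Real.sqrt 2)⁻¹ * (gphi ((Real.sqrt 2)⁻¹ * (y + a / s))) := by
    obtain ⟨C, hC0, hC⟩ := Wt0.2
    refine ⟨?_, (Real.sqrt 2)⁻¹ * (C * (4 + 2 * (a / s) ^ 2)), by positivity, fun y => ?_⟩
    · exact continuous_const.mul (gphi_cont.comp (by fun_prop))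
    · rw [abs_mul, abs_of_pos (by positivity : 0 < (Real.sqrt 2)⁻¹), mul_assoc]
      refine mul_le_mul_of_nonneg_left ((hC _).trans ?_) (by positivity)
      rw [mul_assoc]
      refine mul_le_mul_of_nonneg_left ?_ hC0
      rw [mul_pow, inv_pow, Real.sq_sqrt (by norm_num), inv_eq_one_div, ← div_eq_mul_inv,
        div_le_div_iff₀ (by positivity) (by positivity)]
      set k := a / s
      nlinarith [sq_nonneg (y + 2 * k), sq_nonneg (k * (y + k)), sq_nonneg k, sq_nonneg (y + k)]
  refine integral_mono ((Wt0.integrable_mul hG hB s (x + a)).const_mul _) ?_ ?_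
  · have := hk.integrable_mul hG hB s (x + a)
    convert! this using 2
    ring
  · intro y
    show Real.exp (-(A ^ 2 / (4 * d * ρ))) / Real.sqrt 2 * (G (x + a + s * y) * gphi y) ≤
      (Real.sqrt 2)⁻¹ * (G (x + a + s * y) * gphi ((Real.sqrt 2)⁻¹ * (y + a / s)))
    have key : Real.exp (-(A ^ 2 / (4 * d * ρ))) * gphi y ≤ gphi ((Real.sqrt 2)⁻¹ * (y + a / s)) := by
      unfold gphi
      rw [mul_left_comm, ← Real.exp_add]
      refine mul_le_mul_of_nonneg_left (Real.exp_le_exp.2 ?_) (by positivity)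
      rw [mul_pow, inv_pow, Real.sq_sqrt (by norm_num)]
      have h5 : (a / s) ^ 2 ≤ A ^ 2 / (2 * d * ρ) := by
        rw [div_pow, hss]
        refine div_le_div_of_nonneg_right ?_ (by positivity)
        rw [← sq_abs a]
        exact pow_le_pow_left₀ (abs_nonneg _) ha 2
      have h6 : A ^ 2 / (4 * d * ρ) = A ^ 2 / (2 * d * ρ) / 2 := by
        field_simp; ring
      rw [h6]
      set k := a / s
      nlinarith [sq_nonneg (y - k)]
    have := mul_le_mul_of_nonneg_left key (mul_nonneg (inv_pos.2 h2).le (hG0 (x + a + s * y)))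
    calc _ = (Real.sqrt 2)⁻¹ * G (x + a + s * y) * (Real.exp (-(A ^ 2 / (4 * d * ρ))) * gphi y) := by ring
      _ ≤ _ := this
      _ = _ := by ring

def hcst (d ρ C A : ℝ) : ℝ := Real.exp (-(3 * C * ρ)) * (Real.exp (-(A ^ 2 / (4 * d * ρ))) / Real.sqrt 2)

theorem hcst_pos (d ρ C A : ℝ) : 0 < hcst d ρ C A := by
  unfold hcst; positivity

theorem LinSol.harnack {d ρ C a A : ℝ} (hd : 0 < d) (hρ : 0 < ρ) (ha : |a| ≤ A) {b q : ℝ → ℝ → ℝ}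
    (h : LinSol d b q)
    (hb : ∀ t x, |b t x| ≤ C) (h0 : ∀ x, 0 ≤ q 0 x) (x : ℝ) :
    hcst d ρ C A * q ρ (x + a) ≤ q (2 * ρ) x := by
  obtain ⟨R0, hR0⟩ := h.bdd 0
  have hB : ∀ x, |q 0 x| ≤ R0 := hR0 0 le_rfl le_rfl
  have hc := slice_cont h.cont 0
  have h1 := h.upper hd hb h0 ρ hρ.le (x + a)
  have h2 := h.lower hd hb h0 (2 * ρ) (by positivity) x
  have h3 := kernel_harnack hd hρ ha hc h0 hB x
  have h4 : 0 < Real.exp (-(A ^ 2 / (4 * d * ρ))) / Real.sqrt 2 := by positivity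
  refine le_trans ?_ h2
  unfold hcst
  set c := Real.exp (-(A ^ 2 / (4 * d * ρ))) / Real.sqrt 2
  calc Real.exp (-(3 * C * ρ)) * c * q ρ (x + a)
      ≤ Real.exp (-(3 * C * ρ)) * c * (Real.exp (C * ρ) * heatP d ρ (q 0) (x + a)) :=
        mul_le_mul_of_nonneg_left h1 (by positivity)
    _ = (Real.exp (-(3 * C * ρ)) * Real.exp (C * ρ)) * (c * heatP d ρ (q 0) (x + a)) := by ring
    _ = Real.exp (-C * (2 * ρ)) * (c * heatP d ρ (q 0) (x + a)) := by
        rw [← Real.exp_add]; congr 2; ring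
    _ ≤ _ := mul_le_mul_of_nonneg_left h3 (Real.exp_pos _).le

def Rseq (L R : ℝ) : ℕ → ℝ
  | 0 => R
  | k + 1 => Rseq L R k + ((⌈2 * Rseq L R k / L⌉₊ + 1 : ℕ) : ℝ) * L

def aseq (L R : ℝ) (k : ℕ) : ℝ := ((⌈2 * Rseq L R k / L⌉₊ + 1 : ℕ) : ℝ) * L

def Hseq (a : ℕ → ℝ) (H : ℝ → ℝ → ℝ) : ℕ → ℝ → ℝ → ℝ
  | 0 => H
  | k + 1 => fun t x => (1 / 2) * (Hseq a H k t x + Hseq a H k t (x + a k))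

def mseq (θ : ℕ → ℝ) : ℕ → ℕ → ℝ
  | 0 => fun k => (1 / 2) ^ k
  | n + 1 => fun k => mseq θ n k - θ k * (mseq θ n k - mseq θ n (k + 1))

theorem mseq_anti {θ : ℕ → ℝ} (h0 : ∀ k, 0 < θ k) (h1 : ∀ k, θ k ≤ 1) (n : ℕ) :
    ∀ k, mseq θ n (k + 1) ≤ mseq θ n k := by
  induction n with
  | zero =>
    intro k
    simp only [mseq]
    exact pow_le_pow_of_le_one (by norm_num) (by norm_num) (Nat.le_succ k)
  | succ n ih =>
    intro k
    simp only [mseq]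
    nlinarith [ih k, ih (k + 1), h0 k, h1 k, h0 (k + 1), h1 (k + 1)]

theorem mseq_nonneg {θ : ℕ → ℝ} (h0 : ∀ k, 0 < θ k) (h1 : ∀ k, θ k ≤ 1) (n : ℕ) :
    ∀ k, 0 ≤ mseq θ n k := by
  induction n with
  | zero => intro k; simp only [mseq]; positivity
  | succ n ih =>
    intro k
    simp only [mseq]
    nlinarith [ih k, ih (k + 1), h0 k, h1 k]

theorem mseq_tendsto {θ : ℕ → ℝ} (h0 : ∀ k, 0 < θ k) (h1 : ∀ k, θ k ≤ 1) :
    Tendsto (fun n => mseq θ n 0) atTop (𝓝 0) := by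
  have hanti : ∀ k, Antitone fun n => mseq θ n k := by
    intro k
    refine antitone_nat_of_succ_le fun n => ?_
    simp only [mseq]
    nlinarith [mseq_anti h0 h1 n k, h0 k]
  have hlim : ∀ k, ∃ l, Tendsto (fun n => mseq θ n k) atTop (𝓝 l) := fun k =>
    ⟨_, tendsto_atTop_ciInf (hanti k) ⟨0, by rintro _ ⟨n, rfl⟩; exact mseq_nonneg h0 h1 n k⟩⟩
  choose l hl using hlim
  have heq : ∀ k, l (k + 1) = l k := by
    intro k
    have a := (hl k).comp (tendsto_add_atTop_nat 1)
    have b := (hl k).sub (((hl k).sub (hl (k + 1))).const_mul (θ k))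
    have := tendsto_nhds_unique a b
    have h2 : θ k * (l k - l (k + 1)) = 0 := by linarith
    rcases mul_eq_zero.1 h2 with h | h
    · exact absurd h (h0 k).ne'
    · linarith
  have hall : ∀ k, l k = l 0 := by
    intro k
    induction k with
    | zero => rfl
    | succ k ih => rw [heq, ih]
  have hle : ∀ k, l 0 ≤ (1 / 2) ^ k := by
    intro k
    rw [← hall k]
    exact (hanti k).le_of_tendsto (hl k) 0
  have hge : 0 ≤ l 0 := ge_of_tendsto' (hl 0) fun n => mseq_nonneg h0 h1 n 0
  have : l 0 ≤ 0 := ge_of_tendsto' (tendsto_pow_atTop_nhds_zero_of_lt_one (by norm_num) (by norm_num)) hle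
  have e : l 0 = 0 := le_antisymm this hge
  rw [← e]
  exact hl 0

theorem Hseq_init {L R : ℝ} (hL : 0 < L) (hR : 0 ≤ R) {H : ℝ → ℝ → ℝ} (h0 : ∀ x, 0 ≤ H 0 x)
    (h1 : ∀ x, H 0 x ≤ 1) (hs : ∀ x, R ≤ |x| → H 0 x = 0) (k : ℕ) :
    0 ≤ Rseq L R k ∧ ∀ x, 0 ≤ Hseq (aseq L R) H k 0 x ∧ Hseq (aseq L R) H k 0 x ≤ (1 / 2) ^ k ∧
      (Rseq L R k ≤ |x| → Hseq (aseq L R) H k 0 x = 0) := by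
  induction k with
  | zero => exact ⟨hR, fun x => ⟨h0 x, by simpa using! h1 x, hs x⟩⟩
  | succ k ih =>
    obtain ⟨iR, ih⟩ := ih
    have ha : 2 * Rseq L R k ≤ aseq L R k := by
      unfold aseq
      have := Nat.le_ceil (2 * Rseq L R k / L)
      rw [div_le_iff₀ hL] at this
      push_cast
      nlinarith
    have ha0 : 0 ≤ aseq L R k := by linarith
    have e : Rseq L R (k + 1) = Rseq L R k + aseq L R k := rfl
    refine ⟨by rw [e]; linarith, fun x => ?_⟩
    have e2 : Hseq (aseq L R) H (k + 1) 0 x = (1 / 2) * (Hseq (aseq L R) H k 0 x +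
      Hseq (aseq L R) H k 0 (x + aseq L R k)) := rfl
    rw [e2, e]
    obtain ⟨p1, p2, p3⟩ := ih x
    obtain ⟨q1, q2, q3⟩ := ih (x + aseq L R k)
    refine ⟨by positivity, ?_, ?_⟩
    · rw [pow_succ]
      rcases le_or_gt (Rseq L R k) |x| with h | h
      · rw [p3 h]; linarith
      · rw [q3]
        · linarith
        · rw [abs_lt] at h
          rw [abs_of_nonneg (by linarith)]
          linarith
    · intro h
      rw [p3 (by linarith), q3]
      · norm_num
      · have := abs_sub_abs_le_abs_sub x (-aseq L R k)
        rw [abs_neg, abs_of_nonneg ha0, sub_neg_eq_add] at this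
        linarith

theorem decay {d ω L C R δ : ℝ} (hd : 0 < d) (hω : 0 < ω) (hL : 0 < L) {χ : ℝ → ℝ}
    (hR : 0 ≤ R) (h0 : ∀ x, 0 ≤ χ x) (h1 : ∀ x, χ x ≤ 1) (hs : ∀ x, R ≤ |x| → χ x = 0) (hδ : 0 < δ) :
    ∃ n : ℕ, 1 ≤ n ∧ ∀ b Φ H : ℝ → ℝ → ℝ, (∀ t x, |b t x| ≤ C) → (∀ t x, b t (x + L) = b t x) →
      LinSol d b Φ → (∀ x, Φ 0 x = 1) → LinSol d b H → (∀ x, H 0 x = χ x) →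
      ∀ x, H (n * ω) x ≤ δ * Φ (n * ω) x := by
  set ρ := ω / 2 with hρdef
  have hρ : 0 < ρ := by positivity
  set a := aseq L R with ha
  set cL := hcst d ρ C L with hcL
  have hcL0 : 0 < cL := hcst_pos _ _ _ _
  set θ : ℕ → ℝ := fun k => min 1 (hcst d ρ C (a k) * (cL * Real.exp (-(C * (2 * ρ))))) with hθ
  have hθ0 : ∀ k, 0 < θ k := fun k => lt_min one_pos (mul_pos (hcst_pos _ _ _ _) (by positivity))
  have hθ1 : ∀ k, θ k ≤ 1 := fun k => min_le_left _ _
  obtain ⟨n, hn1, hn⟩ : ∃ n : ℕ, 1 ≤ n ∧ mseq θ n 0 ≤ δ := by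
    have := (mseq_tendsto hθ0 hθ1).eventually (gt_mem_nhds hδ)
    obtain ⟨n, hn⟩ := (this.and (eventually_ge_atTop 1)).exists
    exact ⟨n, hn.2, hn.1.le⟩
  refine ⟨n, hn1, fun b Φ H hb hbL hΦ hΦ0 hH hH0 => ?_⟩
  have hC : 0 ≤ C := (abs_nonneg _).trans (hb 0 0)
  have hΦn : ∀ t ≥ 0, ∀ x, 0 ≤ Φ t x := hΦ.nonneg hd hb (fun x => by rw [hΦ0]; norm_num)
  have hper : ∀ t ≥ 0, Function.Periodic (Φ t) L := by
    intro t ht x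
    have d1 := ((hΦ.translate hbL).sub hΦ).nonneg hd hb (fun x => by simp [hΦ0]) t ht x
    have d2 := (hΦ.sub (hΦ.translate hbL)).nonneg hd hb (fun x => by simp [hΦ0]) t ht x
    linarith
  have hba : ∀ k t x, b t (x + a k) = b t x := by
    intro k t
    have : Function.Periodic (b t) L := hbL t
    exact this.nat_mul _
  have hΦa : ∀ k, ∀ t ≥ 0, ∀ x, Φ t (x + a k) = Φ t x := by
    intro k t ht
    exact (hper t ht).nat_mul _
  have hHk : ∀ k, LinSol d b (Hseq a H k) := by
    intro k
    induction k with
    | zero => exact hH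
    | succ k ih => exact (ih.add (ih.translate (hba k))).const_mul _
  have hbs : ∀ t0, ∀ t x, |(fun t x => b (t + t0) x) t x| ≤ C := fun t0 t x => hb _ _
  -- ratio bound for Φ
  have ratio : ∀ n : ℕ, ∀ x y, cL * Real.exp (-(C * (2 * ρ))) * Φ (2 * ρ + n * ω) x ≤ Φ (ρ + n * ω) y := by
    intro n x y
    have hn0 : (0:ℝ) ≤ n * ω := by positivity
    have st : ∀ z, cL * Φ (n * ω) z ≤ Φ (ρ + n * ω) y := by
      intro z
      rcases Nat.eq_zero_or_pos n with h | h
      · subst h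
        simp only [Nat.cast_zero, zero_mul, add_zero, hΦ0, mul_one]
        have h2 := hΦ.lower hd hb (fun x => by rw [hΦ0]; norm_num) ρ hρ.le y
        have e : heatP d ρ (Φ 0) y = 1 := by
          unfold heatP JJ
          simp [hΦ0, gphi_integral]
        rw [e, mul_one] at h2
        refine le_trans ?_ h2
        rw [hcL, hcst]
        have e1 : Real.exp (-(3 * C * ρ)) ≤ Real.exp (-C * ρ) := Real.exp_le_exp.2 (by nlinarith [mul_nonneg hC hρ.le])
        have e2 : Real.exp (-(L ^ 2 / (4 * d * ρ))) / Real.sqrt 2 ≤ 1 := by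
          rw [div_le_one (by positivity)]
          refine le_trans (Real.exp_le_one_iff.2 ?_) (Real.one_le_sqrt.2 (by norm_num))
          have : 0 ≤ L ^ 2 / (4 * d * ρ) := by positivity
          linarith
        calc _ ≤ Real.exp (-C * ρ) * 1 := mul_le_mul e1 e2 (by positivity) (by positivity)
          _ = _ := mul_one _
      · have hn1 : (1:ℝ) ≤ n := by exact_mod_cast h
        have ht0 : 0 ≤ n * ω - ρ := by
          rw [hρdef]; nlinarith
        obtain ⟨w, hw, hzw⟩ := (hper (n * ω) hn0).exists_mem_Ico hL z y
        have := (hΦ.shift ht0).harnack hd hρ (a := w - y) (A := L) (by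
          rw [abs_of_nonneg (by linarith [hw.1])]; linarith [hw.2]) (hbs _) (fun x => by
            simpa using hΦn (n * ω - ρ) ht0 x) y
        rw [hzw]
        convert! this using 2
        · ring_nf
        · ring_nf
    have up := (hΦ.shift hn0).upper hd (hbs _) (fun x => by simpa using hΦn (n * ω) hn0 x) (2 * ρ)
      (by positivity) x
    have hb2 := heatP_bound (G := fun x => Φ (0 + n * ω) x) (B := Φ (ρ + n * ω) y / cL) (fun z => by
      rw [zero_add, abs_of_nonneg (hΦn _ hn0 z), le_div_iff₀ hcL0, mul_comm]
      exact st z) d (2 * ρ) x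
    have hb3 := (le_abs_self _).trans hb2
    have ee : Real.exp (-(C * (2 * ρ))) * Real.exp (C * (2 * ρ)) = 1 := by
      rw [← Real.exp_add]; simp
    calc _ ≤ cL * Real.exp (-(C * (2 * ρ))) * (Real.exp (C * (2 * ρ)) * (Φ (ρ + n * ω) y / cL)) :=
          mul_le_mul_of_nonneg_left (up.trans (mul_le_mul_of_nonneg_left hb3 (Real.exp_pos _).le)) (by positivity)
      _ = (Real.exp (-(C * (2 * ρ))) * Real.exp (C * (2 * ρ))) * (cL * (Φ (ρ + n * ω) y / cL)) := by ring
      _ = _ := by rw [ee, one_mul, mul_div_cancel₀ _ hcL0.ne']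
  have main : ∀ n k : ℕ, ∀ x, Hseq a H k (n * ω) x ≤ mseq θ n k * Φ (n * ω) x := by
    intro n
    induction n with
    | zero =>
      intro k x
      have := ((Hseq_init hL hR (H := H) (by simpa [hH0] using h0) (by simpa [hH0] using h1)
        (by simpa [hH0] using hs) k).2 x).2.1
      simpa [hΦ0, mseq] using this
    | succ n ih =>
      intro k x
      have hn0 : (0:ℝ) ≤ n * ω := by positivity
      have q1 : LinSol d b (fun t x => mseq θ n k * Φ t x - Hseq a H k t x) :=
        (hΦ.const_mul _).sub (hHk k)
      have q2 : LinSol d b (fun t x => mseq θ n (k + 1) * Φ t x - Hseq a H (k + 1) t x) :=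
        (hΦ.const_mul _).sub (hHk (k + 1))
      have ha0 : 0 ≤ a k := by rw [ha]; unfold aseq; positivity
      have i1 : ∀ x, 0 ≤ (fun t x => (fun t x => mseq θ n k * Φ t x - Hseq a H k t x) (t + n * ω) x) 0 x :=
        fun x => by simp only [zero_add]; linarith [ih k x]
      have i2 : ∀ x, 0 ≤ (fun t x => (fun t x => mseq θ n (k + 1) * Φ t x - Hseq a H (k + 1) t x) (t + n * ω) x) 0 x :=
        fun x => by simp only [zero_add]; linarith [ih (k + 1) x]
      have hk1 := (q1.shift hn0).harnack hd hρ (a := 0) (A := a k) (by simpa using ha0) (hbs _) i1 x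
      have hk2 := (q1.shift hn0).harnack hd hρ (a := a k) (A := a k) (by rw [abs_of_nonneg ha0]) (hbs _) i1 x
      have hk3 := (q2.shift hn0).nonneg hd (hbs _) i2 ρ hρ.le x
      simp only [add_zero] at hk1 hk2 hk3
      rw [hΦa k _ (by positivity)] at hk2
      have eH : Hseq a H (k + 1) (ρ + n * ω) x = (1 / 2) * (Hseq a H k (ρ + n * ω) x +
        Hseq a H k (ρ + n * ω) (x + a k)) := rfl
      have et : ((n + 1 : ℕ) : ℝ) * ω = 2 * ρ + n * ω := by
        rw [hρdef]; push_cast; ring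
      rw [et]
      have hc := hcst_pos d ρ C (a k)
      have hΔ : 0 ≤ mseq θ n k - mseq θ n (k + 1) := by linarith [mseq_anti hθ0 hθ1 n k]
      have hr := ratio n x x
      have hΦ2 : 0 ≤ Φ (2 * ρ + n * ω) x := hΦn _ (by positivity) x
      have j1 : hcst d ρ C (a k) * ((mseq θ n k - mseq θ n (k + 1)) * Φ (ρ + n * ω) x) ≤
          mseq θ n k * Φ (2 * ρ + n * ω) x - Hseq a H k (2 * ρ + n * ω) x := by
        rw [eH] at hk3
        have : (mseq θ n k - mseq θ n (k + 1)) * Φ (ρ + n * ω) x ≤ 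
            ((mseq θ n k * Φ (ρ + n * ω) x - Hseq a H k (ρ + n * ω) x) + 
            (mseq θ n k * Φ (ρ + n * ω) x - Hseq a H k (ρ + n * ω) (x + a k))) / 2 := by linarith
        have := mul_le_mul_of_nonneg_left this hc.le
        linarith
      have j2 : θ k * Φ (2 * ρ + n * ω) x ≤ hcst d ρ C (a k) * Φ (ρ + n * ω) x := by
        have a1 : θ k ≤ hcst d ρ C (a k) * (cL * Real.exp (-(C * (2 * ρ)))) := min_le_right _ _
        calc _ ≤ hcst d ρ C (a k) * (cL * Real.exp (-(C * (2 * ρ)))) * Φ (2 * ρ + n * ω) x :=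
              mul_le_mul_of_nonneg_right a1 hΦ2
          _ = hcst d ρ C (a k) * (cL * Real.exp (-(C * (2 * ρ))) * Φ (2 * ρ + n * ω) x) := by ring
          _ ≤ _ := mul_le_mul_of_nonneg_left hr hc.le
      have j3 := mul_le_mul_of_nonneg_left j2 hΔ
      simp only [mseq]
      linarith
  intro x
  refine (main n 0 x).trans ?_
  exact mul_le_mul_of_nonneg_right hn (hΦn _ (by positivity) x)


theorem per_bound {a c : ℝ} (ha : 0 < a) (hc : 0 < c) {g : ℝ → ℝ → ℝ}
    (h1 : ∀ t x, g (t + a) x = g t x) (h2 : ∀ t x, g t (x + c) = g t x) (t x : ℝ) :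
    ∃ t' ∈ Icc 0 a, ∃ x' ∈ Icc 0 c, g t x = g t' x' := by
  have p1 : Function.Periodic (fun t => g t x) a := fun t => h1 t x
  obtain ⟨t', ht', e1⟩ := p1.exists_mem_Ico₀ ha t
  have p2 : Function.Periodic (fun x => g t' x) c := fun x => h2 t' x
  obtain ⟨x', hx', e2⟩ := p2.exists_mem_Ico₀ hc x
  exact ⟨t', Ico_subset_Icc_self ht', x', Ico_subset_Icc_self hx', e1.trans e2⟩

theorem f_bdd {ω L : ℝ} {f : ℝ → ℝ → ℝ → ℝ} (hω : 0 < ω) (hL : 0 < L) (hf : BasicAssumptions ω L f)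
    (R : ℝ) : ∃ A, 0 ≤ A ∧ ∀ t x u, 0 ≤ u → u ≤ R → |f t x u| ≤ A := by
  have hK : IsCompact (Icc (0:ℝ) ω ×ˢ (Icc (0:ℝ) L ×ˢ Icc (0:ℝ) R)) :=
    isCompact_Icc.prod (isCompact_Icc.prod isCompact_Icc)
  obtain ⟨A, hA⟩ := hK.exists_bound_of_continuousOn (hf.cont.mono (fun q hq => hq.2.2.1))
  refine ⟨|A|, abs_nonneg _, fun t x u hu huR => ?_⟩
  obtain ⟨t', ht', x', hx', e⟩ := per_bound hω hL (g := fun t x => f t x u)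
    (fun t x => hf.per_t t x u hu) (fun t x => hf.per_x t x u hu) t x
  have := hA (t', x', u) ⟨ht', hx', hu, huR⟩
  rw [e]
  exact this.trans (le_abs_self _)

theorem slope_fu {g g' : ℝ → ℝ} (h : ∀ u, 0 ≤ u → HasDerivWithinAt g (g' u) (Ici 0) u) {a b : ℝ}
    (ha : 0 ≤ a) (hab : a < b) : ∃ ξ ∈ Ioo a b, g' ξ = (g b - g a) / (b - a) := by
  refine exists_hasDerivAt_eq_slope g g' hab ?_ ?_
  · intro u hu
    exact ((h u (ha.trans hu.1)).continuousWithinAt).mono (fun y hy => ha.trans hy.1)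
  · intro u hu
    exact (h u (ha.trans hu.1.le)).hasDerivAt (Ici_mem_nhds (lt_of_le_of_lt ha hu.1))

theorem f_lip {ω L : ℝ} {f : ℝ → ℝ → ℝ → ℝ} (hω : 0 < ω) (hL : 0 < L) (hf : BasicAssumptions ω L f)
    (R : ℝ) : ∃ Λ, 0 ≤ Λ ∧ ∀ t x u v, 0 ≤ u → u ≤ R → 0 ≤ v → v ≤ R →
      |f t x u - f t x v| ≤ Λ * |u - v| := by
  obtain ⟨fu, h1, h2⟩ := hf.c1
  obtain ⟨δ, hδ, h3⟩ := h2 1 one_pos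
  obtain ⟨A, hA0, hA⟩ := f_bdd hω hL hf (R + δ)
  refine ⟨1 + 2 * A / δ, by positivity, fun t x u v hu huR hv hvR => ?_⟩
  have hb : ∀ u ∈ Icc (0:ℝ) R, ‖fu t x u‖ ≤ 1 + 2 * A / δ := by
    intro u hu
    obtain ⟨ξ, hξ, e⟩ := slope_fu (h1 t x) hu.1 (b := u + δ) (by linarith)
    have k1 := h3 t x u ξ hu.1 (hu.1.trans hξ.1.le) (by rw [abs_le]; constructor <;> linarith [hξ.1, hξ.2])
    have k2 : |fu t x ξ| ≤ 2 * A / δ := by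
      rw [e, abs_div, show u + δ - u = δ by ring, abs_of_pos hδ]
      apply div_le_div_of_nonneg_right _ hδ.le
      have a1 := hA t x (u + δ) (by linarith [hu.1]) (by linarith [hu.2])
      have a2 := hA t x u hu.1 (by linarith [hu.2])
      have := abs_sub (f t x (u + δ)) (f t x u)
      linarith
    rw [Real.norm_eq_abs]
    have := abs_sub_abs_le_abs_sub (fu t x u) (fu t x ξ)
    linarith
  have := (convex_Icc (0:ℝ) R).norm_image_sub_le_of_norm_hasDerivWithin_le
    (f := fun w => f t x w) (f' := fu t x)
    (fun u hu => (h1 t x u hu.1).mono (fun y hy => hy.1)) hb ⟨hv, hvR⟩ ⟨hu, huR⟩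
  simpa using this

def clampF (f : ℝ → ℝ → ℝ → ℝ) (K : ℝ) (t x u : ℝ) : ℝ := f t x (max 0 (min u K))

theorem clampF_eq {f : ℝ → ℝ → ℝ → ℝ} {K u : ℝ} (h0 : 0 ≤ u) (h1 : u ≤ K) (t x : ℝ) :
    clampF f K t x u = f t x u := by
  unfold clampF; rw [min_eq_left h1, max_eq_right h0]

theorem clamp_mem {K : ℝ} (hK : 0 ≤ K) (u : ℝ) : 0 ≤ max 0 (min u K) ∧ max 0 (min u K) ≤ K :=
  ⟨le_max_left _ _, max_le hK (min_le_right _ _)⟩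

theorem clamp_lip (K u v : ℝ) : |max 0 (min u K) - max 0 (min v K)| ≤ |u - v| := by
  have h1 := abs_max_sub_max_le_abs (min u K) (min v K) 0
  have h2 := abs_min_sub_min_le_max u K v K
  rw [max_comm 0, max_comm 0]
  simp at h2
  exact h1.trans h2

theorem clamp_sol {d ω L : ℝ} {f : ℝ → ℝ → ℝ → ℝ} (hd : 0 < d) (hω : 0 < ω) (hL : 0 < L)
    (hf : BasicAssumptions ω L f) {K : ℝ} (hK : 0 ≤ K) {u0 : ℝ → ℝ} {B0 K0 : ℝ}
    (hB0 : ∀ x, |u0 x| ≤ B0) (hK0 : 0 ≤ K0) (hL0 : ∀ x y, |u0 x - u0 y| ≤ K0 * |x - y|) :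
    ∃ u : ℝ → ℝ → ℝ, Continuous (fun q : ℝ × ℝ => u q.1 q.2) ∧ (∀ x, u 0 x = u0 x) ∧
      HeatOp d u (fun t x => clampF f K t x (u t x)) ∧
      (∀ T, ∃ R, ∀ t, 0 ≤ t → t ≤ T → ∀ x, |u t x| ≤ R) ∧
      (∀ T, ∃ K, 0 ≤ K ∧ ∀ t, 0 ≤ t → t ≤ T → ∀ x y, |u t x - u t y| ≤ K * |x - y|) := by
  obtain ⟨Λ, hΛ, hlip⟩ := f_lip hω hL hf K
  obtain ⟨α, hα, hH⟩ := hf.holder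
  obtain ⟨C, hC, hCH⟩ := hH (K + 1) (by linarith)
  refine exists_sol (F := clampF f K) (Λ := Λ) (B := 0) (α := α) hd ?_ hΛ ?_ ?_ hα ?_ hB0 hK0 hL0
  · have : Continuous (fun q : ℝ × ℝ × ℝ => ((q.1, q.2.1, max 0 (min q.2.2 K)) : ℝ × ℝ × ℝ)) := by
      fun_prop
    exact hf.cont.comp_continuous this (fun q => (clamp_mem hK _).1)
  · intro t x u v
    refine (hlip t x _ _ (clamp_mem hK u).1 (clamp_mem hK u).2 (clamp_mem hK v).1 (clamp_mem hK v).2).trans ?_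
    exact mul_le_mul_of_nonneg_left (clamp_lip K u v) hΛ
  · intro t x
    rw [clampF_eq le_rfl hK, hf.zero]; simp
  · intro R
    refine ⟨C, hC.le, fun t x y u _ => ?_⟩
    have := hCH t t x y _ (clamp_mem hK u).1 ((clamp_mem hK u).2.trans (by linarith))
    have e : (0:ℝ) ^ (α / 2) = 0 := Real.zero_rpow (by have := hα.1; positivity)
    rw [sub_self, abs_zero, e, zero_add] at this
    exact this

theorem IsCauchySolution.heatOp {d : ℝ} {f : ℝ → ℝ → ℝ → ℝ} {v₀ : ℝ → ℝ} {v : ℝ → ℝ → ℝ}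
    (h : IsCauchySolution d f v₀ v) : HeatOp d v (fun t x => f t x (v t x)) :=
  fun t ht x => h.pde (t, x) ht

theorem HypH.heatOp {d ω L : ℝ} {f : ℝ → ℝ → ℝ → ℝ} {p : ℝ → ℝ → ℝ}
    (h : HypH d ω L f p) : HeatOp d p (fun t x => f t x (p t x)) :=
  fun t _ x => h.sol (t, x) trivial

/-- comparison for bounded nonnegative solutions -/
theorem compare {d ω L : ℝ} {f : ℝ → ℝ → ℝ → ℝ} (hd : 0 < d) (hω : 0 < ω) (hL : 0 < L)
    (hf : BasicAssumptions ω L f) {R : ℝ} {u w : ℝ → ℝ → ℝ}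
    (hu : HeatOp d u (fun t x => f t x (u t x))) (hw : HeatOp d w (fun t x => f t x (w t x)))
    (hcu : ContinuousOn (fun q : ℝ × ℝ => u q.1 q.2) {q | 0 ≤ q.1})
    (hcw : ContinuousOn (fun q : ℝ × ℝ => w q.1 q.2) {q | 0 ≤ q.1})
    (hu0 : ∀ t ≥ 0, ∀ x, 0 ≤ u t x ∧ u t x ≤ R) (hw0 : ∀ t ≥ 0, ∀ x, 0 ≤ w t x ∧ w t x ≤ R)
    (h0 : ∀ x, u 0 x ≤ w 0 x) : ∀ t ≥ 0, ∀ x, u t x ≤ w t x := by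
  obtain ⟨Λ, hΛ, hlip⟩ := f_lip hω hL hf R
  have := max_principle hd.le (hu.sub hw) (hcu.sub hcw) (fun T => ⟨R, fun t ht _ x => by
    linarith [(hu0 t ht x).2, (hw0 t ht x).1]⟩) (fun x => by linarith [h0 x]) Λ (by
    intro t ht x hpos
    have := hlip t x (u t x) (w t x) (hu0 t ht.le x).1 (hu0 t ht.le x).2 (hw0 t ht.le x).1 (hw0 t ht.le x).2
    rw [abs_of_pos hpos] at this
    exact (le_abs_self _).trans this)
  intro t ht x
  linarith [this t ht x]

/-- solution starting from a large constant -/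
theorem exists_w {d ω L : ℝ} {f : ℝ → ℝ → ℝ → ℝ} (hd : 0 < d) (hω : 0 < ω) (hL : 0 < L)
    (hf : BasicAssumptions ω L f) {K : ℝ} (hK : 0 ≤ K) (hneg : ∀ t x u : ℝ, K ≤ u → f t x u ≤ 0) :
    ∃ w, IsCauchySolution d f (fun _ => K) w ∧ (∀ t ≥ 0, ∀ x, 0 ≤ w t x ∧ w t x ≤ K) := by
  obtain ⟨w, hc, hi, ho, hb, -⟩ := clamp_sol hd hω hL hf hK (u0 := fun _ => K) (B0 := |K|) (K0 := 0)
    (fun _ => le_rfl) le_rfl (fun x y => by simp)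
  have up := max_principle hd.le (ho.sub (HeatOp.const d K)) ((hc.continuousOn).sub continuousOn_const)
    (fun T => by
      obtain ⟨R, hR⟩ := hb T
      exact ⟨R - K, fun t h0 h1 x => by linarith [le_abs_self (w t x), hR t h0 h1 x]⟩)
    (fun x => by rw [hi]; simp) 0 (by
      intro t ht x hpos
      have : clampF f K t x (w t x) = f t x K := by
        unfold clampF; rw [min_eq_right (by linarith), max_eq_right hK]
      rw [this]
      linarith [hneg t x K le_rfl])
  have lo := max_principle hd.le (ho.const_mul (-1)) ((hc.const_mul (-1)).continuousOn)
    (fun T => by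
      obtain ⟨R, hR⟩ := hb T
      exact ⟨R, fun t h0 h1 x => by linarith [neg_abs_le (w t x), hR t h0 h1 x]⟩)
    (fun x => by rw [hi]; linarith) 0 (by
      intro t ht x hpos
      have : clampF f K t x (w t x) = f t x 0 := by
        unfold clampF; rw [min_eq_left (by linarith), max_eq_left (by linarith)]
      rw [this, hf.zero]; simp)
  have hr : ∀ t ≥ 0, ∀ x, 0 ≤ w t x ∧ w t x ≤ K := fun t ht x =>
    ⟨by linarith [lo t ht x], by linarith [up t ht x]⟩
  refine ⟨w, ⟨hi, hc.continuousOn, ?_, ⟨K, fun t ht x => ?_⟩⟩, hr⟩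
  · rintro ⟨t, x⟩ ht
    have := ho t ht x
    beta_reduce at this
    rw [clampF_eq (hr t (le_of_lt ht) x).1 (hr t (le_of_lt ht) x).2] at this
    exact this
  · rw [abs_of_nonneg (hr t ht x).1]; exact (hr t ht x).2


theorem HypH.per_nat {d ω L : ℝ} {f : ℝ → ℝ → ℝ → ℝ} {p : ℝ → ℝ → ℝ}
    (h : HypH d ω L f p) (n : ℕ) (t x : ℝ) : p (t + n * ω) x = p t x := by
  have : Function.Periodic (fun t => p t x) ω := fun t => h.per_t t x
  exact this.nat_mul n t

theorem p_cont_bdd {d ω L : ℝ} {f : ℝ → ℝ → ℝ → ℝ} {p : ℝ → ℝ → ℝ} (hd : 0 < d) (hω : 0 < ω) (hL : 0 < L)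
    (hf : BasicAssumptions ω L f) (hp : HypH d ω L f p) :
    Continuous (fun q : ℝ × ℝ => p q.1 q.2) ∧ ∃ P, ∀ t x, p t x ≤ P := by
  obtain ⟨M, hM, hneg⟩ := hf.neg_large
  obtain ⟨w, hw, hw0⟩ := exists_w hd hω hL hf hM.le hneg
  have hconv := hp.conv (fun _ => M) continuous_const ⟨|M|, fun _ => le_rfl⟩ ⟨M, hM, fun _ => le_rfl⟩ w hw
  have key : ∀ ε > 0, ∀ t₁ : ℝ, ∃ n : ℕ, 0 < t₁ + n * ω ∧ ∀ t ≥ t₁, ∀ x, |p t x - w (t + n * ω) x| ≤ ε := by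
    intro ε hε t₁
    obtain ⟨S, hS⟩ := hconv ε hε
    obtain ⟨n, hn⟩ := exists_nat_gt ((|S| + |t₁|) / ω)
    rw [div_lt_iff₀ hω] at hn
    have a1 := neg_abs_le t₁
    have a2 := le_abs_self S
    have a3 := abs_nonneg S
    refine ⟨n, by linarith, fun t ht x => ?_⟩
    have := hS (t₁ + n * ω) (by linarith) (t - t₁) (by linarith) x
    rw [show t - t₁ + (t₁ + n * ω) = t + n * ω by ring, hp.per_nat, abs_sub_comm] at this
    exact this
  constructor
  · apply continuous_of_locally_uniform_approx_of_continuousAt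
    rintro ⟨t0, x0⟩ U hU
    obtain ⟨ε, hε, hεU⟩ := Metric.mem_uniformity_dist.1 hU
    obtain ⟨n, hn, h⟩ := key (ε / 2) (by linarith) (t0 - 1)
    refine ⟨{q | t0 - 1 < q.1}, (isOpen_lt continuous_const continuous_fst).mem_nhds (by simp),
      fun q => w (q.1 + n * ω) q.2, ?_, ?_⟩
    · have h1 : ContinuousAt (fun q : ℝ × ℝ => w q.1 q.2) (t0 + n * ω, x0) :=
        hw.cont.continuousAt ((mem_of_superset ((isOpen_lt continuous_const continuous_fst).mem_nhds
          (show (0:ℝ) < ((t0 + n * ω, x0) : ℝ × ℝ).1 by simp; linarith)) (fun q (hq : (0:ℝ) < q.1) => hq.le)))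
      have h2 : ContinuousAt (fun q : ℝ × ℝ => ((q.1 + n * ω, q.2) : ℝ × ℝ)) (t0, x0) := by fun_prop
      exact ContinuousAt.comp (g := fun q : ℝ × ℝ => w q.1 q.2) (x := ((t0, x0) : ℝ × ℝ)) h1 h2
    · rintro ⟨t, x⟩ ht
      apply hεU
      rw [Real.dist_eq]
      exact lt_of_le_of_lt (h t (le_of_lt ht) x) (by linarith)
  · refine ⟨M + 1, fun t x => ?_⟩
    obtain ⟨n, hn, h⟩ := key 1 one_pos t
    have h1 := (abs_le.1 (h t le_rfl x)).2
    have h2 := (hw0 (t + n * ω) hn.le x).2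
    linarith

theorem p_low {d ω L : ℝ} {f : ℝ → ℝ → ℝ → ℝ} {p : ℝ → ℝ → ℝ} (hω : 0 < ω) (hL : 0 < L)
    (hp : HypH d ω L f p) (hc : Continuous (fun q : ℝ × ℝ => p q.1 q.2)) :
    ∃ m > 0, ∀ t x, m ≤ p t x := by
  have hK : IsCompact (Icc (0:ℝ) ω ×ˢ Icc (0:ℝ) L) := isCompact_Icc.prod isCompact_Icc
  obtain ⟨q, hq, hmin⟩ := hK.exists_isMinOn ⟨(0, 0), ⟨le_rfl, hω.le⟩, ⟨le_rfl, hL.le⟩⟩ hc.continuousOn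
  refine ⟨p q.1 q.2, hp.pos _ _, fun t x => ?_⟩
  obtain ⟨t', ht', x', hx', e⟩ := per_bound hω hL hp.per_t hp.per_x t x
  rw [e]
  exact hmin (show ((t', x') : ℝ × ℝ) ∈ _ from ⟨ht', hx'⟩)

theorem v_upper {d ω L : ℝ} {f : ℝ → ℝ → ℝ → ℝ} {p : ℝ → ℝ → ℝ} (hd : 0 < d) (hω : 0 < ω) (hL : 0 < L)
    (hf : BasicAssumptions ω L f) (hp : HypH d ω L f p) {v₀ : ℝ → ℝ} {v : ℝ → ℝ → ℝ}
    (hv : IsCauchySolution d f v₀ v) (hv_nonneg : ∀ t ≥ (0:ℝ), ∀ x, 0 ≤ v t x) :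
    ∀ ε > 0, ∃ S, ∀ t ≥ S, ∀ x, v t x ≤ p t x + ε := by
  obtain ⟨M, hM, hneg⟩ := hf.neg_large
  obtain ⟨C, hC⟩ := hv.bdd
  set K := max M C with hKdef
  have hKM : M ≤ K := le_max_left _ _
  have hKC : C ≤ K := le_max_right _ _
  obtain ⟨w, hw, hw0⟩ := exists_w hd hω hL hf (K := K) (by linarith) (fun t x u hu => hneg t x u (hKM.trans hu))
  have hconv := hp.conv (fun _ => K) continuous_const ⟨|K|, fun _ => le_rfl⟩ ⟨K, by linarith, fun _ => le_rfl⟩ w hw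
  have hvK : ∀ t ≥ 0, ∀ x, v t x ≤ K := fun t ht x => (le_abs_self _).trans ((hC t ht x).trans hKC)
  have hcmp := compare hd hω hL hf (R := K) hv.heatOp hw.heatOp hv.cont hw.cont
    (fun t ht x => ⟨hv_nonneg t ht x, hvK t ht x⟩) hw0 (fun x => by rw [hw.init]; exact hvK 0 le_rfl x)
  intro ε hε
  obtain ⟨S, hS⟩ := hconv ε hε
  refine ⟨max S 0, fun t ht x => ?_⟩
  have h1 := hS t ((le_max_left _ _).trans ht) 0 le_rfl x
  rw [zero_add] at h1
  have := hcmp t ((le_max_right _ _).trans ht) x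
  linarith [(abs_le.1 h1).2]

theorem per_lip {g : ℝ → ℝ} {L : ℝ} (hL : 0 < L) (hper : ∀ x, g (x + L) = g x)
    (h1 : ∀ x, DifferentiableAt ℝ g x) (h2 : ∀ x, DifferentiableAt ℝ (deriv g) x) :
    ∃ K, 0 ≤ K ∧ ∀ x y, |g x - g y| ≤ K * |x - y| := by
  have hc : Continuous (deriv g) := continuous_iff_continuousAt.2 fun x => (h2 x).continuousAt
  have hp : Function.Periodic (deriv g) L := by
    intro x
    rw [← deriv_comp_add_const]
    congr 1
    funext y; exact hper y
  obtain ⟨B, hB⟩ := isCompact_Icc.exists_bound_of_continuousOn (s := Icc (0:ℝ) L) hc.continuousOn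
  refine ⟨|B|, abs_nonneg _, fun x y => ?_⟩
  have := convex_univ.norm_image_sub_le_of_norm_deriv_le (f := g) (C := |B|) (fun x _ => h1 x) (fun x _ => by
    obtain ⟨y, hy, e⟩ := hp.exists_mem_Ico₀ hL x
    rw [e]; exact (hB y (Ico_subset_Icc_self hy)).trans (le_abs_self _)) (mem_univ y) (mem_univ x)
  simpa using this

theorem p_lip {d ω L : ℝ} {f : ℝ → ℝ → ℝ → ℝ} {p : ℝ → ℝ → ℝ} (hd : 0 < d) (hω : 0 < ω) (hL : 0 < L)
    (hf : BasicAssumptions ω L f) (hp : HypH d ω L f p) :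
    ∃ K, 0 ≤ K ∧ ∀ t x y, |p t x - p t y| ≤ K * |x - y| := by
  obtain ⟨hc, P, hP⟩ := p_cont_bdd hd hω hL hf hp
  have hP0 : 0 ≤ P := (hp.pos 0 0).le.trans (hP 0 0)
  obtain ⟨K0, hK0, hl⟩ := per_lip hL (hp.per_x 0) (fun x => (hp.sol (0, x) trivial).1)
    (fun x => (hp.sol (0, x) trivial).2.1)
  obtain ⟨u, huc, hui, huo, hub, hul⟩ := clamp_sol hd hω hL hf hP0 (u0 := p 0) (B0 := P)
    (fun x => by rw [abs_of_pos (hp.pos 0 x)]; exact hP 0 x) hK0 hl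
  have hpo : HeatOp d p (fun t x => clampF f P t x (p t x)) := hp.heatOp.congr (fun t _ x =>
    (clampF_eq (hp.pos t x).le (hP t x) t x).symm)
  obtain ⟨Λ, hΛ, hlip⟩ := f_lip hω hL hf P
  have hlipF : ∀ t x u v, |clampF f P t x u - clampF f P t x v| ≤ Λ * |u - v| := by
    intro t x u v
    refine (hlip t x _ _ (clamp_mem hP0 u).1 (clamp_mem hP0 u).2 (clamp_mem hP0 v).1 (clamp_mem hP0 v).2).trans ?_
    exact mul_le_mul_of_nonneg_left (clamp_lip P u v) hΛ
  have c1 := max_principle hd.le (huo.sub hpo) (huc.sub hc).continuousOn (fun T => by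
      obtain ⟨R, hR⟩ := hub T
      exact ⟨R, fun t h0 h1 x => by linarith [le_abs_self (u t x), hR t h0 h1 x, hp.pos t x]⟩)
      (fun x => by rw [hui]; simp) Λ (fun t ht x hpos => by
        have := hlipF t x (u t x) (p t x)
        rw [abs_of_pos hpos] at this
        exact (le_abs_self _).trans this)
  have c2 := max_principle hd.le (hpo.sub huo) (hc.sub huc).continuousOn (fun T => by
      obtain ⟨R, hR⟩ := hub T
      exact ⟨R + P, fun t h0 h1 x => by linarith [neg_abs_le (u t x), hR t h0 h1 x, hP t x]⟩)
      (fun x => by rw [hui]; simp) Λ (fun t ht x hpos => by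
        have := hlipF t x (p t x) (u t x)
        rw [abs_of_pos hpos] at this
        exact (le_abs_self _).trans this)
  obtain ⟨K, hK, hKl⟩ := hul ω
  refine ⟨K, hK, fun t x y => ?_⟩
  have hper : Function.Periodic p ω := fun t => funext (hp.per_t t)
  obtain ⟨s, hs, e⟩ := hper.exists_mem_Ico₀ hω t
  rw [e]
  have e1 : ∀ x, p s x = u s x := fun x => by linarith [c1 s hs.1 x, c2 s hs.1 x]
  rw [e1, e1]
  exact hKl s hs.1 hs.2.le x y

/-- spatial decay at a fixed time -/
theorem v_decay {d ω L : ℝ} {f : ℝ → ℝ → ℝ → ℝ} (hd : 0 < d) (hω : 0 < ω) (hL : 0 < L)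
    (hf : BasicAssumptions ω L f) {v₀ : ℝ → ℝ} (hv₀_cont : Continuous v₀)
    (hv₀_supp : HasCompactSupport v₀) {v : ℝ → ℝ → ℝ}
    (hv : IsCauchySolution d f v₀ v) (hv_nonneg : ∀ t ≥ (0:ℝ), ∀ x, 0 ≤ v t x) {T : ℝ} (hT : 0 ≤ T)
    {ε : ℝ} (hε : 0 < ε) : ∃ R, 0 ≤ R ∧ ∀ x, R ≤ |x| → v T x ≤ ε := by
  obtain ⟨C, hC⟩ := hv.bdd
  obtain ⟨Λ, hΛ, hlip⟩ := f_lip hω hL hf C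
  have hvC : ∀ t ≥ 0, ∀ x, v t x ≤ C := fun t ht x => (le_abs_self _).trans (hC t ht x)
  have main : ∀ b : ℝ, b ^ 2 = 1 → ∃ A, 0 ≤ A ∧ ∀ x, v T x ≤ A * Real.exp (b * x) := by
    intro b hb
    obtain ⟨A, hA⟩ : ∃ A, ∀ x, v₀ x * Real.exp (-(b * x)) ≤ A := by
      have hs : HasCompactSupport (fun x => v₀ x * Real.exp (-(b * x))) := hv₀_supp.mul_right
      have hcc : Continuous (fun x => v₀ x * Real.exp (-(b * x))) := by fun_prop
      obtain ⟨A, hA⟩ := hcc.bounded_above_of_compact_support hs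
      exact ⟨A, fun x => (le_abs_self _).trans (hA x)⟩
    have hA0 : 0 ≤ A := by
      have := hA 0
      have h2 := hv_nonneg 0 le_rfl 0
      rw [hv.init] at h2
      simp at this
      linarith
    have := max_principle hd.le (hv.heatOp.sub ((HeatOp.exp_exp d (Λ + d) b).const_mul A))
      (hv.cont.sub (by fun_prop)) (fun T => ⟨C, fun t h0 _ x => by
        have : 0 ≤ A * (Real.exp ((Λ + d) * t) * Real.exp (b * x)) := by positivity
        linarith [hvC t h0 x]⟩) (fun x => by
        rw [hv.init]
        have h1 := hA x
        rw [Real.exp_neg, ← div_eq_mul_inv, div_le_iff₀ (Real.exp_pos _)] at h1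
        simp
        linarith) Λ (by
        intro t ht x hpos
        have h1 := hlip t x (v t x) 0 (hv_nonneg t ht.le x) (hvC t ht.le x) le_rfl
          ((hv_nonneg t ht.le x).trans (hvC t ht.le x))
        rw [hf.zero, sub_zero, sub_zero, abs_of_nonneg (hv_nonneg t ht.le x)] at h1
        have h2 := (le_abs_self _).trans h1
        rw [hb]
        nlinarith [h2])
    refine ⟨A * Real.exp ((Λ + d) * T), by positivity, fun x => ?_⟩
    linarith [this T hT x]
  obtain ⟨A1, hA1, h1⟩ := main 1 (by norm_num)
  obtain ⟨A2, hA2, h2⟩ := main (-1) (by norm_num)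
  set A := A1 + A2 + 1 with hA
  have hApos : 0 < A := by positivity
  refine ⟨|Real.log (A / ε)|, abs_nonneg _, fun x hx => ?_⟩
  have h3 : v T x ≤ A * Real.exp (-|x|) := by
    rcases le_total 0 x with h | h
    · rw [abs_of_nonneg h]
      have := h2 x
      rw [neg_one_mul] at this
      exact this.trans (mul_le_mul_of_nonneg_right (by linarith) (Real.exp_pos _).le)
    · rw [abs_of_nonpos h]
      have := h1 x
      rw [one_mul] at this
      rw [neg_neg]
      exact this.trans (mul_le_mul_of_nonneg_right (by linarith) (Real.exp_pos _).le)
  have h4 : Real.exp (-|x|) ≤ ε / A := by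
    rw [← Real.log_le_log_iff (Real.exp_pos _) (by positivity), Real.log_exp,
      Real.log_div hε.ne' hApos.ne']
    have := (le_abs_self (Real.log (A / ε))).trans hx
    rw [Real.log_div hApos.ne' hε.ne'] at this
    linarith
  calc v T x ≤ A * Real.exp (-|x|) := h3
    _ ≤ A * (ε / A) := mul_le_mul_of_nonneg_left h4 hApos.le
    _ = ε := by field_simp


theorem concave_of_hyp {g : ℝ → ℝ} {a b : ℝ} (hab : a < b) (hc : ContDiffOn ℝ 2 g (Icc a b))
    (h2 : ∀ w ∈ Icc a b, derivWithin (derivWithin g (Icc a b)) (Icc a b) w ≤ 0) :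
    ConcaveOn ℝ (Icc a b) g := by
  have hu : UniqueDiffOn ℝ (Icc a b) := uniqueDiffOn_Icc hab
  have hd1 : DifferentiableOn ℝ g (Icc a b) := hc.differentiableOn (by norm_num)
  have hd2 : DifferentiableOn ℝ (derivWithin g (Icc a b)) (Icc a b) := by
    have : ContDiffOn ℝ 1 (derivWithin g (Icc a b)) (Icc a b) := hc.derivWithin hu (by norm_num)
    exact this.differentiableOn (by norm_num)
  refine concaveOn_of_hasDerivWithinAt2_nonpos (convex_Icc a b) hc.continuousOn
    (f' := derivWithin g (Icc a b)) (f'' := derivWithin (derivWithin g (Icc a b)) (Icc a b)) ?_ ?_ ?_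
  · intro x hx
    exact (hd1 x (interior_subset hx)).hasDerivWithinAt.mono interior_subset
  · intro x hx
    exact (hd2 x (interior_subset hx)).hasDerivWithinAt.mono interior_subset
  · intro x hx
    exact h2 x (interior_subset hx)

theorem lip_to_holder {g : ℝ → ℝ} {K P α : ℝ} (hα : α ∈ Ioo (0:ℝ) 1) (hK : 0 ≤ K) (hP : 0 ≤ P)
    (hl : ∀ x y, |g x - g y| ≤ K * |x - y|) (hb : ∀ x y, |g x - g y| ≤ P) (x y : ℝ) :
    |g x - g y| ≤ (K + P) * |x - y| ^ α := by
  rcases le_total |x - y| 1 with h | h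
  · have h1 : |x - y| ≤ |x - y| ^ α := by
      rcases (abs_nonneg (x - y)).eq_or_lt with e | e
      · rw [← e]; positivity
      · calc |x - y| = |x - y| ^ (1:ℝ) := (Real.rpow_one _).symm
          _ ≤ _ := Real.rpow_le_rpow_of_exponent_ge e h hα.2.le
    have h2 := hl x y
    have h3 := mul_le_mul_of_nonneg_left h1 hK
    have h4 : 0 ≤ P * |x - y| ^ α := by positivity
    linarith
  · have h1 : 1 ≤ |x - y| ^ α := Real.one_le_rpow h hα.1.le
    have h2 := hb x y
    have h3 := mul_le_mul_of_nonneg_left h1 hP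
    have h4 : 0 ≤ K * |x - y| ^ α := by positivity
    linarith

theorem slopes {d ω L : ℝ} {f : ℝ → ℝ → ℝ → ℝ} {p : ℝ → ℝ → ℝ} (hd : 0 < d) (hω : 0 < ω) (hL : 0 < L)
    (hf : BasicAssumptions ω L f) (hp : HypH d ω L f p) {m P ε₀ : ℝ} (hm : 0 < m) (hmp : ∀ t x, m ≤ p t x)
    (hP : ∀ t x, p t x ≤ P) (hpc : Continuous (fun q : ℝ × ℝ => p q.1 q.2)) (hε₀ : 0 < ε₀)
    (hex : ∀ t x : ℝ,
      ContDiffOn ℝ 2 (fun w => f t x w)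
        (Set.Icc ((1 - ε₀) * p t x) ((1 + ε₀) * p t x)) ∧
      AntitoneOn (fun w => f t x w / w)
        (Set.Icc ((1 - ε₀) * p t x) ((1 + ε₀) * p t x)) ∧
      (∀ w ∈ Set.Icc ((1 - ε₀) * p t x) ((1 + ε₀) * p t x),
        derivWithin (derivWithin (fun z => f t x z)
            (Set.Icc ((1 - ε₀) * p t x) ((1 + ε₀) * p t x)))
          (Set.Icc ((1 - ε₀) * p t x) ((1 + ε₀) * p t x)) w ≤ 0)) :
    ∃ Λ, 0 ≤ Λ ∧ ∀ η > 0, ∃ b : ℝ → ℝ → ℝ, (∀ t x, |b t x| ≤ Λ) ∧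
      Continuous (fun q : ℝ × ℝ => b q.1 q.2) ∧
      (∃ α ∈ Ioo (0:ℝ) 1, ∃ C, 0 ≤ C ∧ ∀ t x y, |b t x - b t y| ≤ C * |x - y| ^ α) ∧
      (∀ t x, b t (x + L) = b t x) ∧
      (∀ t x z, z ≤ 0 → -(ε₀ * m) ≤ z → f t x (p t x + z) - f t x (p t x) ≤ b t x * z) ∧
      (∀ t x z, 0 ≤ z → z ≤ ε₀ * m → f t x (p t x + z) - f t x (p t x) ≤ (b t x + η) * z) ∧
      (∀ t x, b t x * p t x ≤ f t x (p t x)) := by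
  obtain ⟨Λ, hΛ, hlip⟩ := f_lip hω hL hf (P + 1)
  refine ⟨Λ, hΛ, fun η hη => ?_⟩
  obtain ⟨fu, hfu, huc⟩ := hf.c1
  obtain ⟨δ, hδ, hδu⟩ := huc η hη
  have hpe : 0 < ε₀ * m := by positivity
  obtain ⟨h, hh, h1, hhm, hhe, hhδ⟩ : ∃ h > 0, h ≤ 1 ∧ h ≤ m ∧ h ≤ ε₀ * m ∧ 2 * h ≤ δ := by
    refine ⟨min (min 1 m) (min (ε₀ * m) (δ / 2)), ?_, ?_, ?_, ?_, ?_⟩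
    · simp only [gt_iff_lt, lt_min_iff]
      exact ⟨⟨one_pos, hm⟩, hpe, by linarith⟩
    · exact (min_le_left _ _).trans (min_le_left _ _)
    · exact (min_le_left _ _).trans (min_le_right _ _)
    · exact (min_le_right _ _).trans (min_le_left _ _)
    · have := (min_le_right (min 1 m) (min (ε₀ * m) (δ / 2))).trans (min_le_right _ _)
      linarith
  have hp0 : ∀ t x, 0 ≤ p t x := fun t x => (hp.pos t x).le
  have hI : ∀ t x z, -(ε₀ * m) ≤ z → z ≤ ε₀ * m →
      p t x + z ∈ Icc ((1 - ε₀) * p t x) ((1 + ε₀) * p t x) := by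
    intro t x z hz1 hz2
    have := mul_le_mul_of_nonneg_left (hmp t x) hε₀.le
    constructor <;> linarith
  have hIp : ∀ t x, p t x ∈ Icc ((1 - ε₀) * p t x) ((1 + ε₀) * p t x) := by
    intro t x
    simpa using hI t x 0 (by linarith) (by linarith)
  have hcc : ∀ t x, ConcaveOn ℝ (Icc ((1 - ε₀) * p t x) ((1 + ε₀) * p t x)) (fun w => f t x w) := by
    intro t x
    refine concave_of_hyp ?_ (hex t x).1 (hex t x).2.2
    have := mul_pos hε₀ (hp.pos t x)
    linarith
  obtain ⟨Kp, hKp, hpl⟩ := p_lip hd hω hL hf hp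
  set b : ℝ → ℝ → ℝ := fun t x => (f t x (p t x + h) - f t x (p t x)) / h with hb
  have hP0 : 0 ≤ P := (hp0 0 0).trans (hP 0 0)
  refine ⟨b, ?_, ?_, ?_, ?_, ?_, ?_, ?_⟩
  · intro t x
    have := hlip t x (p t x + h) (p t x) (by linarith [hp0 t x]) (by linarith [hP t x]) (hp0 t x) (by linarith [hP t x])
    rw [add_sub_cancel_left, abs_of_pos hh] at this
    rw [hb, abs_div, abs_of_pos hh, div_le_iff₀ hh]
    exact this
  · refine Continuous.div_const (Continuous.sub ?_ ?_) h
    · exact hf.cont.comp_continuous (f := fun q : ℝ × ℝ => ((q.1, q.2, p q.1 q.2 + h) : ℝ × ℝ × ℝ))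
        (by fun_prop) (fun q => by have := hp0 q.1 q.2; show 0 ≤ p q.1 q.2 + h; linarith)
    · exact hf.cont.comp_continuous (f := fun q : ℝ × ℝ => ((q.1, q.2, p q.1 q.2) : ℝ × ℝ × ℝ))
        (by fun_prop) (fun q => hp0 q.1 q.2)
  · obtain ⟨α, hα, hH⟩ := hf.holder
    obtain ⟨C, hC, hCH⟩ := hH (P + 1) (by linarith)
    refine ⟨α, hα, 2 * (C + Λ * (Kp + P)) / h, by positivity, fun t x y => ?_⟩
    have e : (0:ℝ) ^ (α / 2) = 0 := Real.zero_rpow (by have := hα.1; positivity)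
    have key : ∀ k, 0 ≤ k → k ≤ 1 → |f t x (p t x + k) - f t y (p t y + k)| ≤ (C + Λ * (Kp + P)) * |x - y| ^ α := by
      intro k hk0 hk1
      have a1 := hCH t t x y (p t x + k) (by linarith [hp0 t x]) (by linarith [hP t x])
      rw [sub_self, abs_zero, e, zero_add] at a1
      have a2 := hlip t y (p t x + k) (p t y + k) (by linarith [hp0 t x]) (by linarith [hP t x])
        (by linarith [hp0 t y]) (by linarith [hP t y])
      rw [add_sub_add_right_eq_sub] at a2
      have a3 := lip_to_holder hα hKp hP0 (hpl t) (fun x y => by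
        rw [abs_le]; constructor <;> linarith [hp0 t x, hp0 t y, hP t x, hP t y]) x y
      have a4 := mul_le_mul_of_nonneg_left a3 hΛ
      have a5 := abs_sub_le (f t x (p t x + k)) (f t y (p t x + k)) (f t y (p t y + k))
      linarith
    have k1 := key h hh.le h1
    have k2 := key 0 le_rfl zero_le_one
    rw [add_zero, add_zero] at k2
    rw [hb]
    simp only
    rw [← sub_div, abs_div, abs_of_pos hh, div_mul_eq_mul_div]
    apply div_le_div_of_nonneg_right _ hh.le
    rw [sub_sub_sub_comm]
    have := abs_sub (f t x (p t x + h) - f t y (p t y + h)) (f t x (p t x) - f t y (p t y))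
    linarith
  · intro t x
    simp only [hb]
    rw [hp.per_x, hf.per_x _ _ _ (by linarith [hp0 t x]), hf.per_x _ _ _ (hp0 t x)]
  · intro t x z hz0 hz1
    rcases hz0.eq_or_lt with rfl | hz
    · simp
    have := (hcc t x).slope_anti_adjacent (hI t x z hz1 (by linarith)) (hI t x h (by linarith) hhe)
      (y := p t x) (by linarith) (by linarith)
    simp only [add_sub_cancel_left, sub_add_cancel_left] at this
    rw [le_div_iff₀ (by linarith)] at this
    simp only [hb]
    linarith
  · intro t x z hz0 hz1
    rcases hz0.eq_or_lt with rfl | hz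
    · simp
    have hle : p t x + -h ∈ _ := hI t x (-h) (by linarith) (by linarith)
    have := (hcc t x).slope_anti_adjacent hle (hI t x z (by linarith) hz1)
      (y := p t x) (by linarith) (by linarith)
    simp only [add_sub_cancel_left, sub_add_cancel_left, neg_neg] at this
    rw [div_le_iff₀ hz] at this
    refine this.trans (mul_le_mul_of_nonneg_right ?_ hz.le)
    obtain ⟨ξ1, hξ1, e1⟩ := slope_fu (hfu t x) (a := p t x + -h) (b := p t x) (by linarith [hmp t x]) (by linarith)
    obtain ⟨ξ2, hξ2, e2⟩ := slope_fu (hfu t x) (a := p t x) (b := p t x + h) (hp0 t x) (by linarith)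
    have e3 : b t x = fu t x ξ2 := by rw [e2, hb]; simp
    simp only [sub_add_cancel_left, neg_neg] at e1
    rw [← e1, e3]
    have := hδu t x ξ1 ξ2 (by linarith [hξ1.1, hmp t x]) (by linarith [hξ2.1, hp0 t x])
      (by rw [abs_le]; constructor <;> linarith [hξ1.1, hξ1.2, hξ2.1, hξ2.2])
    linarith [(abs_le.1 this).2]
  · intro t x
    have := (hex t x).2.1 (hIp t x) (hI t x h (by linarith) hhe) (by linarith)
    simp only at this
    have pp := hp.pos t x
    rw [div_le_div_iff₀ (by linarith) pp] at this
    simp only [hb]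
    rw [div_mul_eq_mul_div, div_le_iff₀ hh]
    linarith


theorem exists_linSol {d Λ : ℝ} (hd : 0 < d) {b : ℝ → ℝ → ℝ} (hΛ : 0 ≤ Λ) (hb : ∀ t x, |b t x| ≤ Λ)
    (hbc : Continuous (fun q : ℝ × ℝ => b q.1 q.2))
    (hbh : ∃ α ∈ Ioo (0:ℝ) 1, ∃ C, 0 ≤ C ∧ ∀ t x y, |b t x - b t y| ≤ C * |x - y| ^ α)
    {χ : ℝ → ℝ} {B0 K0 : ℝ} (hB0 : ∀ x, |χ x| ≤ B0) (hK0 : 0 ≤ K0)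
    (hL0 : ∀ x y, |χ x - χ y| ≤ K0 * |x - y|) : ∃ q, LinSol d b q ∧ ∀ x, q 0 x = χ x := by
  obtain ⟨α, hα, C, hC, hH⟩ := hbh
  obtain ⟨u, h1, h2, h3, h4, -⟩ := exists_sol (F := fun t x u => b t x * u) (Λ := Λ) (B := 0) (α := α) hd
    (Continuous.mul (hbc.comp (f := fun q : ℝ × ℝ × ℝ => (q.1, q.2.1)) (by fun_prop)) (by fun_prop)) hΛ
    (fun t x u v => by
      rw [← mul_sub, abs_mul]
      exact mul_le_mul_of_nonneg_right (hb t x) (abs_nonneg _))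
    (fun t x => by simp) hα (fun R => ⟨C * |R|, by positivity, fun t x y u hu => by
      rw [← sub_mul, abs_mul]
      have := mul_le_mul (hH t x y) (hu.trans (le_abs_self R)) (abs_nonneg u) (by positivity)
      linarith⟩) hB0 hK0 hL0
  exact ⟨u, ⟨h3, h1, h4⟩, h2⟩

theorem LinSol.lower_one {d C : ℝ} (hd : 0 < d) {b q : ℝ → ℝ → ℝ} (h : LinSol d b q)
    (hb : ∀ t x, |b t x| ≤ C) (h0 : ∀ x, q 0 x = 1) (t : ℝ) (ht : 0 ≤ t) (x : ℝ) :
    Real.exp (-C * t) ≤ q t x := by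
  have hnn := h.nonneg hd hb (fun x => by rw [h0]; exact zero_le_one)
  have hC : 0 ≤ C := (abs_nonneg _).trans (hb 0 0)
  have := max_principle hd.le (((HeatOp.const d 1).exp_mul (-C)).sub h.op)
    (Continuous.sub (by fun_prop) h.cont).continuousOn
    (fun T => ⟨1, fun t h1 h2 x => by
      have e1 : Real.exp (-C * t) ≤ 1 := by
        rw [Real.exp_le_one_iff]; nlinarith
      linarith [hnn t h1 x]⟩)
    (fun x => by rw [h0]; simp) (-C) (fun t ht x hz => by
      have := (abs_le.1 (hb t x)).1
      nlinarith [hnn t ht.le x]) t ht x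
  linarith

/-- core step: comparison with the linearised barrier -/
theorem core {d ω L : ℝ} {f : ℝ → ℝ → ℝ → ℝ} {p : ℝ → ℝ → ℝ} (hd : 0 < d)
    (hp : HypH d ω L f p) {m P ε₀ : ℝ} (hm : 0 < m) (hmp : ∀ t x, m ≤ p t x)
    (hP : ∀ t x, p t x ≤ P) (hpc : Continuous (fun q : ℝ × ℝ => p q.1 q.2)) 
    {Λ η κ ε : ℝ} (hη : 0 < η) (hκ : 0 < κ) (hε : 0 < ε) (hκP : κ * P ≤ ε₀ * m * m) (hεm : ε ≤ ε₀ * m)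
    {b : ℝ → ℝ → ℝ} (hb : ∀ t x, |b t x| ≤ Λ)
    (hs1 : ∀ t x z, z ≤ 0 → -(ε₀ * m) ≤ z → f t x (p t x + z) - f t x (p t x) ≤ b t x * z)
    (hs2 : ∀ t x z, 0 ≤ z → z ≤ ε₀ * m → f t x (p t x + z) - f t x (p t x) ≤ (b t x + η) * z)
    (hs3 : ∀ t x, b t x * p t x ≤ f t x (p t x))
    {u Φ H : ℝ → ℝ → ℝ} (hu : HeatOp d u (fun t x => f t x (u t x)))
    (huc : ContinuousOn (fun q : ℝ × ℝ => u q.1 q.2) {q | 0 ≤ q.1})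
    (hup : ∀ t ≥ 0, ∀ x, u t x ≤ p t x + ε)
    (hΦ : LinSol d b Φ) (hΦ0 : ∀ x, Φ 0 x = 1) (hH : LinSol d b H) (hH0 : ∀ x, 0 ≤ H 0 x)
    (hi : ∀ x, u 0 x - p 0 x ≤ -κ + (κ + ε) * H 0 x) :
    ∀ t ≥ 0, ∀ x, u t x - p t x ≤ (κ + ε) * (Real.exp (η * t) * H t x) - κ * Φ t x := by
  have hΦn := hΦ.nonneg hd hb (fun x => by rw [hΦ0]; exact zero_le_one)
  have hHn := hH.nonneg hd hb hH0
  have hΦp : ∀ t ≥ 0, ∀ x, m * Φ t x ≤ p t x := by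
    have := max_principle hd.le ((hΦ.op.const_mul m).sub hp.heatOp)
      (Continuous.sub (continuous_const.mul hΦ.cont) hpc).continuousOn
      (fun T => by
        obtain ⟨R, hR⟩ := hΦ.bdd T
        exact ⟨m * R, fun t h1 h2 x => by
          have := mul_le_mul_of_nonneg_left ((le_abs_self _).trans (hR t h1 h2 x)) hm.le
          linarith [hp.pos t x]⟩)
      (fun x => by rw [hΦ0]; linarith [hmp 0 x]) Λ (fun t ht x hz => by
        have h1 := hs3 t x
        have h2 := mul_le_mul_of_nonneg_right ((le_abs_self _).trans (hb t x)) hz.le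
        linarith)
    intro t ht x
    linarith [this t ht x]
  have hκΦ : ∀ t ≥ 0, ∀ x, κ * Φ t x ≤ ε₀ * m := by
    intro t ht x
    have h1 := mul_le_mul_of_nonneg_left ((hΦp t ht x).trans (hP t x)) hκ.le
    have h2 : (κ * Φ t x) * m ≤ (ε₀ * m) * m := by linarith
    exact le_of_mul_le_mul_right h2 hm
  have := max_principle hd.le ((hu.sub hp.heatOp).sub
      (((hH.op.exp_mul η).const_mul (κ + ε)).sub (hΦ.op.const_mul κ)))
    (ContinuousOn.sub (huc.sub hpc.continuousOn) (Continuous.continuousOn (Continuous.sub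
      (continuous_const.mul (Continuous.mul (by fun_prop) hH.cont)) (continuous_const.mul hΦ.cont))))
    (fun T => ⟨ε + ε₀ * m, fun t h1 h2 x => by
      have a1 := hκΦ t h1 x
      have a2 := hup t h1 x
      have a3 : 0 ≤ (κ + ε) * (Real.exp (η * t) * H t x) := by
        have := hHn t h1 x
        positivity
      linarith⟩)
    (fun x => by
      have := hi x
      rw [hΦ0, mul_zero, Real.exp_zero]
      linarith) (Λ + η) (fun t ht x hz => by
      have a1 := hκΦ t ht.le x
      have a2 := hup t ht.le x
      have a3 : 0 ≤ (κ + ε) * (Real.exp (η * t) * H t x) := by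
        have := hHn t ht.le x
        positivity
      have a0 : 0 ≤ κ * Φ t x := mul_nonneg hκ.le (hΦn t ht.le x)
      set E := (κ + ε) * (Real.exp (η * t) * H t x) with hE
      set z := u t x - p t x with hzdef
      have e0 : f t x (u t x) = f t x (p t x + z) := by rw [hzdef]; congr 1; ring
      have e1 : (κ + ε) * (Real.exp (η * t) * (b t x * H t x + η * H t x)) = (b t x + η) * E := by
        rw [hE]; ring
      rw [e1, e0]
      have a4 := mul_le_mul_of_nonneg_right ((le_abs_self _).trans (hb t x)) hz.le
      have a5 := mul_pos hη hz
      rcases le_total z 0 with h | h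
      · have := hs1 t x z h (by linarith)
        have a6 := mul_nonneg hη.le a3
        nlinarith
      · have := hs2 t x z h (by linarith)
        have a6 := mul_nonneg hη.le a0
        nlinarith)
  intro t ht x
  linarith [this t ht x]

theorem cauchy_solution_eventually_below_p
    (d ω L : ℝ) (hd : 0 < d) (hω : 0 < ω) (hL : 0 < L)
    (f : ℝ → ℝ → ℝ → ℝ) (hf : BasicAssumptions ω L f)
    (p : ℝ → ℝ → ℝ) (hp : HypH d ω L f p)
    (hextra : ∃ ε₀ > (0:ℝ), ∀ t x : ℝ,
      ContDiffOn ℝ 2 (fun w => f t x w)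
        (Set.Icc ((1 - ε₀) * p t x) ((1 + ε₀) * p t x)) ∧
      AntitoneOn (fun w => f t x w / w)
        (Set.Icc ((1 - ε₀) * p t x) ((1 + ε₀) * p t x)) ∧
      (∀ w ∈ Set.Icc ((1 - ε₀) * p t x) ((1 + ε₀) * p t x),
        derivWithin (derivWithin (fun z => f t x z)
            (Set.Icc ((1 - ε₀) * p t x) ((1 + ε₀) * p t x)))
          (Set.Icc ((1 - ε₀) * p t x) ((1 + ε₀) * p t x)) w ≤ 0))
    (v₀ : ℝ → ℝ) (hv₀_cont : Continuous v₀) (hv₀_nonneg : ∀ x, 0 ≤ v₀ x)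
    (hv₀_supp : HasCompactSupport v₀)
    (v : ℝ → ℝ → ℝ) (hv : IsCauchySolution d f v₀ v)
    (hv_nonneg : ∀ t ≥ (0:ℝ), ∀ x, 0 ≤ v t x) :
    ∃ t₀ > (0:ℝ), ∃ δ₀ > (0:ℝ), ∀ x : ℝ, v t₀ x ≤ p 0 x - δ₀ := by
  obtain ⟨ε₀, hε₀, hex⟩ := hextra
  obtain ⟨hpc, P, hP⟩ := p_cont_bdd hd hω hL hf hp
  obtain ⟨m, hm, hmp⟩ := p_low hω hL hp hpc
  have hPpos : 0 < P := hm.trans_le ((hmp 0 0).trans (hP 0 0))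
  obtain ⟨Λ, hΛ, hslopes⟩ := slopes hd hω hL hf hp hm hmp hP hpc hε₀ hex
  obtain ⟨κ, hκ, hκP, hκm⟩ : ∃ κ > 0, κ * P ≤ ε₀ * m * m ∧ κ ≤ m / 2 := by
    refine ⟨min (ε₀ * m * m / P) (m / 2), lt_min (by positivity) (by positivity), ?_, min_le_right _ _⟩
    rw [← le_div_iff₀ hPpos]
    exact min_le_left _ _
  obtain ⟨ε, hε, hεκ, hεm⟩ : ∃ ε > 0, ε ≤ κ ∧ ε ≤ ε₀ * m :=
    ⟨min κ (ε₀ * m), lt_min hκ (by positivity), min_le_left _ _, min_le_right _ _⟩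
  obtain ⟨S, hS⟩ := v_upper hd hω hL hf hp hv hv_nonneg ε hε
  obtain ⟨k₀, hk₀⟩ := exists_nat_gt (S / ω)
  rw [div_lt_iff₀ hω] at hk₀
  set T : ℝ := k₀ * ω with hTdef
  have hT : 0 ≤ T := by positivity
  obtain ⟨R, hR, hRv⟩ := v_decay hd hω hL hf hv₀_cont hv₀_supp hv hv_nonneg hT (ε := m / 2) (by positivity)
  set χ : ℝ → ℝ := fun x => max 0 (min (R + 1 - |x|) 1) with hχ
  have hχ0 : ∀ x, 0 ≤ χ x := fun x => le_max_left _ _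
  have hχ1 : ∀ x, χ x ≤ 1 := fun x => max_le zero_le_one (min_le_right _ _)
  have hχs : ∀ x, R + 1 ≤ |x| → χ x = 0 := fun x hx =>
    max_eq_left ((min_le_left _ _).trans (by linarith))
  have hχin : ∀ x, |x| ≤ R → χ x = 1 := fun x hx => by
    simp only [hχ]
    rw [min_eq_right (by linarith), max_eq_right zero_le_one]
  have hχl : ∀ x y, |χ x - χ y| ≤ 1 * |x - y| := by
    intro x y
    refine (clamp_lip 1 _ _).trans ?_
    rw [one_mul, sub_sub_sub_cancel_left, abs_sub_comm x y]
    exact abs_abs_sub_abs_le _ _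
  obtain ⟨n, hn, hdec⟩ := decay (C := Λ) (δ := 1 / 8) hd hω hL (R := R + 1) (by linarith) hχ0 hχ1 hχs (by norm_num)
  have hnω : 0 < (n:ℝ) * ω := by
    have : (1:ℝ) ≤ n := by exact_mod_cast hn
    positivity
  obtain ⟨η, hη, hηn⟩ : ∃ η > 0, Real.exp (η * (n * ω)) = 2 := by
    refine ⟨Real.log 2 / (n * ω), div_pos (Real.log_pos (by norm_num)) hnω, ?_⟩
    rw [div_mul_cancel₀ _ hnω.ne', Real.exp_log (by norm_num)]
  obtain ⟨b, hb, hbc, hbh, hbp, hs1, hs2, hs3⟩ := hslopes η hη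
  obtain ⟨Φ, hΦ, hΦ0⟩ := exists_linSol hd hΛ hb hbc hbh (χ := fun _ => 1) (B0 := 1) (K0 := 0)
    (fun x => by simp) le_rfl (fun x y => by simp)
  obtain ⟨H, hH, hH0⟩ := exists_linSol hd hΛ hb hbc hbh (χ := χ) (B0 := 1) (K0 := 1)
    (fun x => by rw [abs_of_nonneg (hχ0 x)]; exact hχ1 x) zero_le_one hχl
  have hfper : ∀ t x u, 0 ≤ u → f (t + T) x u = f t x u := by
    intro t x u hu0
    have : Function.Periodic (fun t => f t x u) ω := fun t => hf.per_t t x u hu0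
    exact this.nat_mul k₀ t
  have hpT : ∀ t x, p (t + T) x = p t x := hp.per_nat k₀
  have hu : HeatOp d (fun t x => v (t + T) x) (fun t x => f t x (v (t + T) x)) :=
    (hv.heatOp.shift T hT).congr (fun t ht x => hfper t x _ (hv_nonneg _ (by linarith) x))
  have huc : ContinuousOn (fun q : ℝ × ℝ => v (q.1 + T) q.2) {q | 0 ≤ q.1} := by
    refine hv.cont.comp (f := fun q : ℝ × ℝ => ((q.1 + T, q.2) : ℝ × ℝ)) (by fun_prop) ?_
    intro q (hq : 0 ≤ q.1)
    show 0 ≤ q.1 + T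
    linarith
  have hup : ∀ t ≥ 0, ∀ x, v (t + T) x ≤ p t x + ε := by
    intro t ht x
    rw [← hpT]
    exact hS _ (by linarith) x
  have hfin := core hd hp hm hmp hP hpc hη hκ hε hκP hεm hb hs1 hs2 hs3 hu huc hup hΦ hΦ0 hH
    (fun x => by rw [hH0]; exact hχ0 x) (fun x => by
      rw [hH0]
      rcases le_total |x| R with h | h
      · rw [hχin x h]
        linarith [hup 0 le_rfl x]
      · have h1 := hRv x h
        have h2 := mul_nonneg (by linarith : 0 ≤ κ + ε) (hχ0 x)
        rw [zero_add]
        linarith [hmp 0 x])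
  refine ⟨n * ω + T, by linarith, κ / 2 * Real.exp (-Λ * (n * ω)), by positivity, fun x => ?_⟩
  have h1 := hfin (n * ω) hnω.le x
  rw [hηn] at h1
  have h2 := hdec b Φ H hb hbp hΦ hΦ0 hH hH0 x
  have h3 := hΦ.lower_one hd hb hΦ0 (n * ω) hnω.le x
  have h4 : p (n * ω) x = p 0 x := by
    have := hp.per_nat n 0 x
    rwa [zero_add] at this
  have h5 := mul_le_mul_of_nonneg_left h3 (by linarith : 0 ≤ κ / 2)
  have h6 : (κ + ε) * (2 * H (n * ω) x) ≤ (2 * κ) * (2 * (1 / 8 * Φ (n * ω) x)) := by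
    have hΦpos := (Real.exp_pos _).le.trans h3
    calc (κ + ε) * (2 * H (n * ω) x) ≤ (κ + ε) * (2 * (1 / 8 * Φ (n * ω) x)) :=
          mul_le_mul_of_nonneg_left (by linarith) (by linarith)
      _ ≤ _ := mul_le_mul_of_nonneg_right (by linarith) (by linarith)
  rw [h4] at h1
  linarith
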